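/- arXiv:2203.10312 — 4 statements merged into one kernel-verified Lean document; each statement's English description precedes it below -/
import Mathlib

section
/- Let N ≥ 2 and s ∈ (0,1). The function 𝒫_s, defined by 𝒫_s(x) = 𝒦_s x_1^s |x|^{−N} for x ∈ ℝ^N_+ and 𝒫_s(x) = 0 for x ∈ ℝ^N with x_1 ≤ 0, x ≠ 0 (and 𝒫_s(0) = 0), is s-harmonic in the upper half space: for every x ∈ ℝ^N_+, the principal value limit lim_{ε→0^+} c_{N,s} ∫_{{z : ε < |z| < 1/ε}} (𝒫_s(x) − 𝒫_s(x+z)) |z|^{−N−2s} dz exists and equals 0. -/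
open MeasureTheory Real Filter Set Topology

noncomputable section

/-- The normalizing constant `c_{N,s}` of the fractional Laplacian. -/
def cns (N : ℕ) (s : ℝ) : ℝ :=
  (2 : ℝ) ^ (2 * s) * Real.pi ^ (-(N : ℝ) / 2) * s *
    Real.Gamma (((N : ℝ) + 2 * s) / 2) / Real.Gamma (1 - s)

/-- The annulus `{z : ε < |z| < 1/ε}` in `ℝ^N`. -/
def annulus (N : ℕ) (ε : ℝ) : Set (EuclideanSpace ℝ (Fin N)) :=
  {z | ε < ‖z‖ ∧ ‖z‖ < 1 / ε}

/-- The truncated fractional-Laplacian integral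
`∫_{ε<|z|<1/ε} (u(x) - u(x+z)) |z|^{-N-2s} dz` (without the normalizing constant). -/
def pvInt (N : ℕ) (s : ℝ) (u : EuclideanSpace ℝ (Fin N) → ℝ)
    (x : EuclideanSpace ℝ (Fin N)) (ε : ℝ) : ℝ :=
  ∫ z in annulus N ε, (u x - u (x + z)) / ‖z‖ ^ ((N : ℝ) + 2 * s)

/-- `u` is `s`-harmonic at `x` in the principal value sense:
`lim_{ε→0⁺} c_{N,s} ∫_{ε<|z|<1/ε} (u(x) - u(x+z)) |z|^{-N-2s} dz = 0`. -/
def SHarmonicAt (N : ℕ) (s : ℝ) (u : EuclideanSpace ℝ (Fin N) → ℝ)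
    (x : EuclideanSpace ℝ (Fin N)) : Prop :=
  Tendsto (fun ε : ℝ => cns N s * pvInt N s u x ε) (𝓝[>] (0 : ℝ)) (𝓝 0)

/-- The constant `κ_{N,s} = π^{-(N/2+1)} Γ(N/2) sin(πs)`. -/
def kap (N : ℕ) (s : ℝ) : ℝ :=
  Real.pi ^ (-((N : ℝ) / 2 + 1)) * Real.Gamma ((N : ℝ) / 2) * Real.sin (Real.pi * s)

/-- The constant `𝒦_s = κ_{N,s} 2^{2s-1} s^{-1}`. -/
def Ks (N : ℕ) (s : ℝ) : ℝ := kap N s * 2 ^ (2 * s - 1) / s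

/-- The first coordinate vector `e₁` of `ℝ^N`. -/
def e1 (N : ℕ) [NeZero N] : EuclideanSpace ℝ (Fin N) := EuclideanSpace.single 0 1

/-- The fundamental solution `𝒫_s(x) = 𝒦_s x₁^s |x|^{-N}` on `ℝ^N_+`, zero elsewhere. -/
def Ps (N : ℕ) [NeZero N] (s : ℝ) (x : EuclideanSpace ℝ (Fin N)) : ℝ :=
  if 0 < x 0 then Ks N s * (x 0) ^ s * ‖x‖ ^ (-(N : ℝ)) else 0

/-- The function `(y₁)₊ ^ s`. -/
def halfPow (N : ℕ) [NeZero N] (s : ℝ) (y : EuclideanSpace ℝ (Fin N)) : ℝ := (max (y 0) 0) ^ s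

/-- The function `(y₁)₊ ^ s * ‖y‖ ^ (-N)`, the Kelvin transform of `halfPow`. -/
def halfKelvin (N : ℕ) [NeZero N] (s : ℝ) (y : EuclideanSpace ℝ (Fin N)) : ℝ :=
  halfPow N s y * ‖y‖ ^ (-(N : ℝ))

/-- The integrand of the fractional Laplacian of `g` at `x`, in the variable `y = x + z`. -/
def fracKernel (N : ℕ) (s : ℝ) (g : EuclideanSpace ℝ (Fin N) → ℝ)
    (x y : EuclideanSpace ℝ (Fin N)) : ℝ :=
  (g x - g y) / ‖y - x‖ ^ ((N : ℝ) + 2 * s)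

/-- The complement of the union of the ball `closedBall x ε` and its image under the inversion
in the sphere centred at the origin through `x` (and without the origin). -/
def symmExterior {N : ℕ} (x : EuclideanSpace ℝ (Fin N)) (ε : ℝ) :
    Set (EuclideanSpace ℝ (Fin N)) :=
  {y | y ≠ 0 ∧ ε < ‖y - x‖ ∧ ε < ‖EuclideanGeometry.inversion 0 ‖x‖ y - x‖}

lemma inversion_zero_eq {N : ℕ} (R : ℝ) (y : EuclideanSpace ℝ (Fin N)) :
    EuclideanGeometry.inversion 0 R y = (R / ‖y‖) ^ 2 • y := by
  simp [EuclideanGeometry.inversion]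

lemma measurable_inversion_zero {N : ℕ} (R : ℝ) :
    Measurable (fun y : EuclideanSpace ℝ (Fin N) => EuclideanGeometry.inversion 0 R y) := by
  simp_rw [inversion_zero_eq]
  fun_prop

lemma measurableSet_symmExterior {N : ℕ} (x : EuclideanSpace ℝ (Fin N)) (ε : ℝ) :
    MeasurableSet (symmExterior x ε) := by
  have h := measurable_inversion_zero (N := N) ‖x‖
  have h1 : MeasurableSet {y : EuclideanSpace ℝ (Fin N) | ε < ‖y - x‖} :=
    measurableSet_lt (by fun_prop) (by fun_prop)
  have h2 : MeasurableSet {y | ε < ‖EuclideanGeometry.inversion 0 ‖x‖ y - x‖} :=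
    measurableSet_lt (by fun_prop) (by fun_prop)
  exact (measurableSet_singleton (0 : EuclideanSpace ℝ (Fin N))).compl.inter (h1.inter h2)

lemma norm_inversion_zero_sub {N : ℕ} {x y : EuclideanSpace ℝ (Fin N)} (hx : x ≠ 0) (hy : y ≠ 0) :
    ‖EuclideanGeometry.inversion 0 ‖x‖ y - x‖ = ‖x‖ / ‖y‖ * ‖y - x‖ := by
  have h1 : EuclideanGeometry.inversion 0 ‖x‖ x = x := by
    simpa using EuclideanGeometry.inversion_dist_center 0 x
  have h := EuclideanGeometry.dist_inversion_inversion hy hx ‖x‖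
  rw [h1, dist_eq_norm, dist_eq_norm, dist_eq_norm, dist_eq_norm, sub_zero, sub_zero] at h
  have : ‖x‖ ≠ 0 := norm_ne_zero_iff.2 hx
  have : ‖y‖ ≠ 0 := norm_ne_zero_iff.2 hy
  rw [h]
  field_simp

lemma image_inversion_symmExterior {N : ℕ} {x : EuclideanSpace ℝ (Fin N)} (hx : x ≠ 0) (ε : ℝ) :
    EuclideanGeometry.inversion 0 ‖x‖ '' symmExterior x ε = symmExterior x ε := by
  have hR : ‖x‖ ≠ 0 := norm_ne_zero_iff.2 hx
  have key : ∀ y ∈ symmExterior x ε, EuclideanGeometry.inversion 0 ‖x‖ y ∈ symmExterior x ε := by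
    rintro y ⟨h0, h1, h2⟩
    refine ⟨?_, h2, ?_⟩
    · rwa [Ne, EuclideanGeometry.inversion_eq_center hR]
    · rwa [EuclideanGeometry.inversion_inversion _ hR]
  ext y
  constructor
  · rintro ⟨z, hz, rfl⟩
    exact key z hz
  · intro hy
    exact ⟨_, key y hy, EuclideanGeometry.inversion_inversion _ hR _⟩

lemma abs_det_fderiv_inversion {N : ℕ} (R : ℝ) (y : EuclideanSpace ℝ (Fin N)) :
    |(((R / dist y 0) ^ 2 • ((ℝ ∙ (y - 0))ᗮ.reflection :
      EuclideanSpace ℝ (Fin N) →L[ℝ] EuclideanSpace ℝ (Fin N))).det)| = (R / ‖y‖) ^ (2 * N) := by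
  have h := (ℝ ∙ (y - 0))ᗮ.det_reflection
  have h2 : |LinearMap.det ((ℝ ∙ (y - 0))ᗮ.reflection.toLinearMap)| = 1 := by
    rw [h]; simp
  rw [ContinuousLinearMap.det, ContinuousLinearMap.toLinearMap_smul, LinearMap.det_smul, abs_mul]
  have h3 : ((((ℝ ∙ (y - 0))ᗮ.reflection :
      EuclideanSpace ℝ (Fin N) →L[ℝ] EuclideanSpace ℝ (Fin N))) :
      EuclideanSpace ℝ (Fin N) →ₗ[ℝ] EuclideanSpace ℝ (Fin N)) =
      (ℝ ∙ (y - 0))ᗮ.reflection.toLinearMap := rfl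
  rw [h3, h2, mul_one, finrank_euclideanSpace_fin, dist_zero_right, ← pow_mul, abs_of_nonneg]
  rw [pow_mul]; positivity

lemma kelvin_integrand {N : ℕ} [NeZero N] (s : ℝ) {x y : EuclideanSpace ℝ (Fin N)} (hx : x ≠ 0)
    (hy : y ≠ 0) (hyx : y ≠ x) :
    (‖x‖ / ‖y‖) ^ (2 * N) • (halfKelvin N s (EuclideanGeometry.inversion 0 ‖x‖ y) /
      ‖EuclideanGeometry.inversion 0 ‖x‖ y - x‖ ^ ((N : ℝ) + 2 * s)) =
    ‖x‖ ^ (-(N : ℝ)) * (halfPow N s y / ‖y - x‖ ^ ((N : ℝ) + 2 * s)) := by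
  have hx' : 0 < ‖x‖ := norm_pos_iff.2 hx
  have hy' : 0 < ‖y‖ := norm_pos_iff.2 hy
  have hq : 0 < ‖x‖ / ‖y‖ := by positivity
  have hyx' : 0 < ‖y - x‖ := norm_pos_iff.2 (sub_ne_zero.2 hyx)
  rw [norm_inversion_zero_sub hx hy, halfKelvin, halfPow, inversion_zero_eq]
  have h1 : max (((‖x‖ / ‖y‖) ^ 2 • y) 0) 0 = (‖x‖ / ‖y‖) ^ 2 * max (y 0) 0 := by
    rw [mul_max_of_nonneg _ _ (by positivity)]
    simp
  have h2 : ‖(‖x‖ / ‖y‖) ^ 2 • y‖ = ‖x‖ / ‖y‖ * ‖x‖ := by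
    rw [norm_smul, Real.norm_of_nonneg (by positivity)]
    field_simp
  rw [h1, h2, Real.mul_rpow (by positivity) (by positivity), Real.mul_rpow hq.le hx'.le,
    Real.mul_rpow hq.le hyx'.le, halfPow, smul_eq_mul, ← Real.rpow_natCast (‖x‖ / ‖y‖) 2,
    ← Real.rpow_mul hq.le, ← Real.rpow_natCast (‖x‖ / ‖y‖) (2 * N)]
  push_cast
  generalize max (y 0) 0 ^ s = V
  generalize ‖y - x‖ ^ ((N : ℝ) + 2 * s) = K
  have h4 : (‖x‖ / ‖y‖) ^ (2 * (N : ℝ)) * (‖x‖ / ‖y‖) ^ (2 * s) * (‖x‖ / ‖y‖) ^ (-(N : ℝ)) =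
    (‖x‖ / ‖y‖) ^ ((N : ℝ) + 2 * s) := by
    rw [← Real.rpow_add hq, ← Real.rpow_add hq]
    ring_nf
  have h5 : (‖x‖ / ‖y‖) ^ ((N : ℝ) + 2 * s) ≠ 0 := (Real.rpow_pos_of_pos hq _).ne'
  rw [mul_div_assoc', mul_div_assoc', ← div_div]
  congr 1
  rw [div_eq_iff h5, ← h4]
  ring

lemma integrableOn_symmExterior_kelvin {N : ℕ} [NeZero N] (s : ℝ)
    {x : EuclideanSpace ℝ (Fin N)} (hx : x ≠ 0) {ε : ℝ} (hε : 0 < ε) :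
    IntegrableOn (fun y => halfKelvin N s y / ‖y - x‖ ^ ((N : ℝ) + 2 * s)) (symmExterior x ε) ↔
    IntegrableOn (fun y => ‖x‖ ^ (-(N : ℝ)) * (halfPow N s y / ‖y - x‖ ^ ((N : ℝ) + 2 * s)))
      (symmExterior x ε) := by
  have hm := measurableSet_symmExterior x ε
  conv_lhs => rw [← image_inversion_symmExterior hx]
  rw [integrableOn_image_iff_integrableOn_abs_det_fderiv_smul volume hm
    (fun y hy => (EuclideanGeometry.hasFDerivAt_inversion hy.1).hasFDerivWithinAt)
    (EuclideanGeometry.inversion_injective 0 (norm_ne_zero_iff.2 hx)).injOn]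
  refine integrableOn_congr_fun (fun y hy => ?_) hm
  simp only [abs_det_fderiv_inversion]
  exact kelvin_integrand s hx hy.1 (fun h => by have := hy.2.1; simp [h] at this; linarith)

lemma setIntegral_symmExterior_kelvin {N : ℕ} [NeZero N] (s : ℝ)
    {x : EuclideanSpace ℝ (Fin N)} (hx : x ≠ 0) {ε : ℝ} (hε : 0 < ε) :
    ∫ y in symmExterior x ε, halfKelvin N s y / ‖y - x‖ ^ ((N : ℝ) + 2 * s) =
    ‖x‖ ^ (-(N : ℝ)) *
      ∫ y in symmExterior x ε, halfPow N s y / ‖y - x‖ ^ ((N : ℝ) + 2 * s) := by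
  have hm := measurableSet_symmExterior x ε
  conv_lhs => rw [← image_inversion_symmExterior hx]
  rw [integral_image_eq_integral_abs_det_fderiv_smul volume hm
    (fun y hy => (EuclideanGeometry.hasFDerivAt_inversion hy.1).hasFDerivWithinAt)
    (EuclideanGeometry.inversion_injective 0 (norm_ne_zero_iff.2 hx)).injOn, ← integral_const_mul]
  refine setIntegral_congr_fun hm (fun y hy => ?_)
  simp only [abs_det_fderiv_inversion]
  exact kelvin_integrand s hx hy.1 (fun h => by have := hy.2.1; simp [h] at this; linarith)

lemma integrableOn_norm_rpow_exterior {N : ℕ} (hN : 0 < N) {q ε : ℝ} (hq : 0 < q) (hε : 0 < ε) :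
    IntegrableOn (fun z : EuclideanSpace ℝ (Fin N) => ‖z‖ ^ (-(N : ℝ) - q)) {z | ε < ‖z‖} := by
  have : Nontrivial (EuclideanSpace ℝ (Fin N)) := by
    apply Module.nontrivial_of_finrank_pos (R := ℝ)
    simpa using hN
  have hm : MeasurableSet {z : EuclideanSpace ℝ (Fin N) | ε < ‖z‖} :=
    measurableSet_lt (by fun_prop) (by fun_prop)
  rw [← integrable_indicator_iff hm]
  have h := (integrable_fun_norm_addHaar (volume : Measure (EuclideanSpace ℝ (Fin N)))
    (f := (Ioi ε).indicator (fun r : ℝ => r ^ (-(N : ℝ) - q)))).2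
  refine (h ?_).congr (Eventually.of_forall fun z => by simp [indicator])
  have h1 : IntegrableOn (fun r : ℝ => r ^ (-1 - q)) (Ioi ε) :=
    integrableOn_Ioi_rpow_of_lt (by linarith) hε
  have h2 := (integrable_indicator_iff measurableSet_Ioi).2 h1
  refine h2.integrableOn.congr_fun (fun r hr => ?_) measurableSet_Ioi
  by_cases hrε : ε < r
  · have hr' : 0 < r := hr
    simp only [indicator, mem_Ioi, hrε, if_true, smul_eq_mul, finrank_euclideanSpace_fin]
    rw [← Real.rpow_natCast, ← Real.rpow_add hr', Nat.cast_sub (by omega)]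
    congr 1
    push_cast
    ring
  · simp [indicator, hrε]

lemma integrableOn_norm_rpow_closedBall {N : ℕ} (hN : 0 < N) {q a : ℝ} (hq : 0 < q) :
    IntegrableOn (fun z : EuclideanSpace ℝ (Fin N) => ‖z‖ ^ (q - (N : ℝ))) {z | ‖z‖ ≤ a} := by
  have : Nontrivial (EuclideanSpace ℝ (Fin N)) := by
    apply Module.nontrivial_of_finrank_pos (R := ℝ)
    simpa using hN
  have hm : MeasurableSet {z : EuclideanSpace ℝ (Fin N) | ‖z‖ ≤ a} :=
    measurableSet_le (by fun_prop) (by fun_prop)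
  rw [← integrable_indicator_iff hm]
  have h := (integrable_fun_norm_addHaar (volume : Measure (EuclideanSpace ℝ (Fin N)))
    (f := (Iic a).indicator (fun r : ℝ => r ^ (q - (N : ℝ))))).2
  refine (h ?_).congr (Eventually.of_forall fun z => by simp [indicator])
  have h1 : IntegrableOn (fun r : ℝ => r ^ (q - 1)) (Ioc 0 a) := by
    by_cases ha : 0 ≤ a
    · rw [← intervalIntegrable_iff_integrableOn_Ioc_of_le ha]
      exact intervalIntegral.intervalIntegrable_rpow' (by linarith)
    · rw [Ioc_eq_empty (by intro h; exact ha h.le)]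
      simp
  have h2 := (integrable_indicator_iff measurableSet_Ioc).2 h1
  refine h2.integrableOn.congr_fun (fun r hr => ?_) measurableSet_Ioi
  have hr' : 0 < r := hr
  by_cases hra : r ≤ a
  · simp only [indicator, mem_Ioc, mem_Iic, hra, hr', true_and, if_true, smul_eq_mul,
      finrank_euclideanSpace_fin]
    rw [← Real.rpow_natCast, ← Real.rpow_add hr', Nat.cast_sub (by omega)]
    congr 1
    push_cast
    ring
  · simp [indicator, hra]

lemma measurable_halfPow {N : ℕ} [NeZero N] (s : ℝ) : Measurable (halfPow N s) := by
  unfold halfPow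
  fun_prop

lemma measurable_halfKelvin {N : ℕ} [NeZero N] (s : ℝ) : Measurable (halfKelvin N s) := by
  have := measurable_halfPow (N := N) s
  unfold halfKelvin
  fun_prop

lemma halfPow_nonneg {N : ℕ} [NeZero N] (s : ℝ) (y : EuclideanSpace ℝ (Fin N)) :
    0 ≤ halfPow N s y := Real.rpow_nonneg (le_max_right _ _) _

lemma halfPow_le {N : ℕ} [NeZero N] {s : ℝ} (hs : 0 ≤ s) (y : EuclideanSpace ℝ (Fin N)) :
    halfPow N s y ≤ ‖y‖ ^ s := by
  refine Real.rpow_le_rpow (le_max_right _ _) (max_le ?_ (norm_nonneg _)) hs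
  exact (le_abs_self _).trans (PiLp.norm_apply_le y 0)

lemma integrableOn_translate {N : ℕ} {f : EuclideanSpace ℝ (Fin N) → ℝ}
    (x : EuclideanSpace ℝ (Fin N)) {p : ℝ → Prop} (hp : MeasurableSet {r | p r})
    (hf : IntegrableOn f {z | p ‖z‖}) :
    IntegrableOn (fun y => f (y - x)) {y | p ‖y - x‖} := by
  have hm : MeasurableSet {z : EuclideanSpace ℝ (Fin N) | p ‖z‖} := measurable_norm hp
  have hm' : MeasurableSet {y : EuclideanSpace ℝ (Fin N) | p ‖y - x‖} :=
    (measurable_norm.comp (measurable_id.sub_const x)) hp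
  rw [← integrable_indicator_iff hm] at hf
  rw [← integrable_indicator_iff hm']
  exact hf.comp_sub_right x

lemma integrableOn_halfPow_exterior {N : ℕ} [NeZero N] {s : ℝ} (hs : s ∈ Ioo (0 : ℝ) 1)
    (x : EuclideanSpace ℝ (Fin N)) {ε : ℝ} (hε : 0 < ε) :
    IntegrableOn (fun y => halfPow N s y / ‖y - x‖ ^ ((N : ℝ) + 2 * s)) {y | ε < ‖y - x‖} := by
  have hN : 0 < N := Nat.pos_of_ne_zero (NeZero.ne N)
  have h := integrableOn_translate x (p := fun r => ε < r) measurableSet_Ioi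
    (integrableOn_norm_rpow_exterior hN hs.1 hε)
  have hm : MeasurableSet {y : EuclideanSpace ℝ (Fin N) | ε < ‖y - x‖} :=
    measurableSet_lt (by fun_prop) (by fun_prop)
  have := measurable_halfPow (N := N) s
  refine (h.const_mul ((‖x‖ / ε + 1) ^ s)).mono'
    (by fun_prop : Measurable fun y => halfPow N s y / ‖y - x‖ ^ ((N : ℝ) + 2 * s)).aestronglyMeasurable
    ?_
  rw [ae_restrict_iff' hm]
  refine Eventually.of_forall fun y (hy : ε < ‖y - x‖) => ?_
  have hr : 0 < ‖y - x‖ := hε.trans hy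
  rw [norm_div, Real.norm_of_nonneg (halfPow_nonneg s y), Real.norm_of_nonneg (by positivity),
    div_le_iff₀ (by positivity), mul_assoc, ← Real.rpow_add hr]
  ring_nf
  rw [mul_comm]
  have h1 := halfPow_le hs.1.le y
  refine h1.trans ?_
  rw [← Real.mul_rpow (by positivity) (by positivity)]
  refine Real.rpow_le_rpow (by positivity) ?_ hs.1.le
  have h2 : ‖y‖ ≤ ‖y - x‖ + ‖x‖ := by simpa using norm_add_le (y - x) x
  have h3 : ‖x‖ ≤ ‖y - x‖ * (‖x‖ / ε) := by
    rw [mul_div_assoc', le_div_iff₀ hε]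
    nlinarith [norm_nonneg x]
  have : ε⁻¹ * ‖x‖ = ‖x‖ / ε := by field_simp
  nlinarith

lemma integrableOn_kernel_exterior {N : ℕ} (hN : 0 < N) {s : ℝ} (hs : 0 < s)
    (x : EuclideanSpace ℝ (Fin N)) {ε : ℝ} (hε : 0 < ε) :
    IntegrableOn (fun y => 1 / ‖y - x‖ ^ ((N : ℝ) + 2 * s)) {y | ε < ‖y - x‖} := by
  have h := integrableOn_translate x (p := fun r => ε < r) measurableSet_Ioi
    (integrableOn_norm_rpow_exterior hN (q := 2 * s) (by linarith) hε)
  refine h.congr (Eventually.of_forall fun y => ?_)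
  simp only [one_div]
  rw [← Real.rpow_neg (norm_nonneg _)]
  ring_nf

lemma one_add_pow_le_one_add_mul {a : ℝ} (h0 : 0 ≤ a) (h1 : a ≤ 1) (n : ℕ) :
    (1 + a) ^ n ≤ 1 + a * (2 ^ n - 1) := by
  induction n with
  | zero => simp
  | succ n ih =>
    have hM : (1 : ℝ) ≤ 2 ^ n := one_le_pow₀ (by norm_num)
    rw [pow_succ, pow_succ]
    have h2 := mul_le_mul_of_nonneg_right ih (by linarith : 0 ≤ 1 + a)
    have h3 : a * a * ((2 : ℝ) ^ n - 1) ≤ a * ((2 : ℝ) ^ n - 1) := by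
      apply mul_le_mul_of_nonneg_right _ (by linarith)
      nlinarith
    nlinarith

/-- The part of the exterior of `closedBall x ε` that is not in `symmExterior x ε`. -/
def symmShell {N : ℕ} (x : EuclideanSpace ℝ (Fin N)) (ε : ℝ) : Set (EuclideanSpace ℝ (Fin N)) :=
  {y | y ≠ 0 ∧ ε < ‖y - x‖} \ symmExterior x ε

lemma measurableSet_punctured_exterior {N : ℕ} (x : EuclideanSpace ℝ (Fin N)) (ε : ℝ) :
    MeasurableSet {y : EuclideanSpace ℝ (Fin N) | y ≠ 0 ∧ ε < ‖y - x‖} := by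
  have h1 : MeasurableSet {y : EuclideanSpace ℝ (Fin N) | ε < ‖y - x‖} :=
    measurableSet_lt (by fun_prop) (by fun_prop)
  exact (measurableSet_singleton (0 : EuclideanSpace ℝ (Fin N))).compl.inter h1

lemma measurableSet_symmShell {N : ℕ} (x : EuclideanSpace ℝ (Fin N)) (ε : ℝ) :
    MeasurableSet (symmShell x ε) :=
  (measurableSet_punctured_exterior x ε).diff (measurableSet_symmExterior x ε)

lemma symmShell_subset {N : ℕ} {x : EuclideanSpace ℝ (Fin N)} (hx : x ≠ 0) {ε : ℝ} (hε : 0 < ε)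
    (hε' : 2 * ε ≤ ‖x‖) :
    symmShell x ε ⊆ Metric.closedBall x (ε * (1 + 2 * ε / ‖x‖)) \ Metric.closedBall x ε := by
  have hR : 0 < ‖x‖ := norm_pos_iff.2 hx
  rintro y ⟨⟨hy0, hy1⟩, hy2⟩
  have hy3 : ‖EuclideanGeometry.inversion 0 ‖x‖ y - x‖ ≤ ε := by
    by_contra h
    exact hy2 ⟨hy0, hy1, not_le.1 h⟩
  have hy' : 0 < ‖y‖ := norm_pos_iff.2 hy0
  rw [norm_inversion_zero_sub hx hy0, div_mul_eq_mul_div, div_le_iff₀ hy'] at hy3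
  have htri : ‖y‖ ≤ ‖y - x‖ + ‖x‖ := by simpa using norm_add_le (y - x) x
  simp only [Set.mem_sdiff, Metric.mem_closedBall, dist_eq_norm, not_le]
  refine ⟨?_, hy1⟩
  set ρ := ‖y - x‖
  have h1 : ‖x‖ * ρ ≤ ε * (ρ + ‖x‖) := hy3.trans (by gcongr)
  have h2 : ρ ≤ 2 * ε := by nlinarith
  have h3 : ε * (1 + 2 * ε / ‖x‖) = ε * (2 * ε + ‖x‖) / ‖x‖ := by field_simp; ring
  rw [h3, le_div_iff₀ hR]
  nlinarith

lemma volume_real_symmShell_le {N : ℕ} {x : EuclideanSpace ℝ (Fin N)} (hx : x ≠ 0) {ε : ℝ}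
    (hε : 0 < ε) (hε' : 2 * ε ≤ ‖x‖) :
    volume.real (symmShell x ε) ≤ 2 * 2 ^ N / ‖x‖ *
      volume.real (Metric.ball (0 : EuclideanSpace ℝ (Fin N)) 1) * ε ^ ((N : ℝ) + 1) := by
  have hR : 0 < ‖x‖ := norm_pos_iff.2 hx
  have hge : ε ≤ ε * (1 + 2 * ε / ‖x‖) := by
    have : 0 ≤ ε * (2 * ε / ‖x‖) := by positivity
    linarith
  have h1 := measureReal_mono (μ := volume) (symmShell_subset hx hε hε')
    ((measure_mono sdiff_subset).trans_lt measure_closedBall_lt_top).ne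
  have hw : 0 ≤ volume.real (Metric.ball (0 : EuclideanSpace ℝ (Fin N)) 1) := measureReal_nonneg
  rw [measureReal_sdiff (Metric.closedBall_subset_closedBall hge) measurableSet_closedBall
    measure_closedBall_lt_top.ne,
    Measure.addHaar_real_closedBall _ _ (hε.le.trans hge), Measure.addHaar_real_closedBall _ _ hε.le,
    finrank_euclideanSpace_fin, mul_pow] at h1
  have ha : 2 * ε / ‖x‖ ≤ 1 := by rwa [div_le_one hR]
  have h2 := one_add_pow_le_one_add_mul (by positivity) ha N
  rw [Real.rpow_add hε, Real.rpow_one, Real.rpow_natCast]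
  set w := volume.real (Metric.ball (0 : EuclideanSpace ℝ (Fin N)) 1)
  have h3 : ε ^ N * w * (1 + 2 * ε / ‖x‖) ^ N ≤
      ε ^ N * w * (1 + 2 * ε / ‖x‖ * (2 ^ N - 1)) := by gcongr
  have h4 : 0 ≤ ε ^ N * w * (2 * ε / ‖x‖) := by positivity
  calc _ ≤ _ := h1
    _ ≤ ε ^ N * w * (2 * ε / ‖x‖ * 2 ^ N) := by linarith
    _ = _ := by ring

lemma norm_le_on_symmShell {N : ℕ} (hN : 0 < N) {s : ℝ} (hs : 0 < s)
    {x : EuclideanSpace ℝ (Fin N)} {f : EuclideanSpace ℝ (Fin N) → ℝ} {L δ : ℝ} (hL : 0 ≤ L)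
    (hf : ∀ y, ‖y - x‖ < δ → ‖f y‖ ≤ L * ‖y - x‖ ^ (1 - ((N : ℝ) + 2 * s)))
    (hx : x ≠ 0) {ε : ℝ} (hε : 0 < ε) (hε' : 2 * ε ≤ ‖x‖) (hεδ : 2 * ε < δ) :
    ∀ y ∈ symmShell x ε, ‖f y‖ ≤ L * ε ^ (1 - ((N : ℝ) + 2 * s)) := by
  intro y hy
  have hR : 0 < ‖x‖ := norm_pos_iff.2 hx
  have h := symmShell_subset hx hε hε' hy
  simp only [Set.mem_sdiff, Metric.mem_closedBall, dist_eq_norm, not_le] at h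
  have ha : 2 * ε / ‖x‖ ≤ 1 := by rwa [div_le_one hR]
  have h1 : ‖y - x‖ < δ := by nlinarith [h.1]
  refine (hf y h1).trans (mul_le_mul_of_nonneg_left ?_ hL)
  have : (1 : ℝ) ≤ N := by exact_mod_cast hN
  exact Real.rpow_le_rpow_of_nonpos hε h.2.le (by linarith)

/-- Replacing annuli by their symmetrised versions does not change principal values. -/
lemma tendsto_annulus_sub_symmExterior {N : ℕ} (hN : 0 < N) {s : ℝ} (hs : s ∈ Ioo (0 : ℝ) 1)
    {x : EuclideanSpace ℝ (Fin N)} {f : EuclideanSpace ℝ (Fin N) → ℝ} {L δ : ℝ} (hL : 0 ≤ L)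
    (hδ : 0 < δ) (hfm : Measurable f)
    (hf : ∀ y, ‖y - x‖ < δ → ‖f y‖ ≤ L * ‖y - x‖ ^ (1 - ((N : ℝ) + 2 * s)))
    (hfi : ∀ ε > 0, IntegrableOn f (symmExterior x ε)) (hx : x ≠ 0) :
    Tendsto (fun ε : ℝ => (∫ y in {y | ε < ‖y - x‖ ∧ ‖y - x‖ < 1 / ε}, f y) -
      ∫ y in symmExterior x ε, f y) (𝓝[>] (0 : ℝ)) (𝓝 0) := by
  have hR : 0 < ‖x‖ := norm_pos_iff.2 hx
  set ε₀ := min (‖x‖ / 2) (δ / 3) with hε₀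
  have hε₀pos : 0 < ε₀ := by positivity
  have hsmall : ∀ ε, ε ≤ ε₀ → 2 * ε ≤ ‖x‖ ∧ 2 * ε < δ := by
    intro ε h
    have h1 := h.trans (min_le_left _ _)
    have h2 := h.trans (min_le_right _ _)
    constructor <;> linarith
  have hev : ∀ᶠ ε in 𝓝[>] (0 : ℝ), 0 < ε ∧ ε ≤ ε₀ := by
    filter_upwards [Ioc_mem_nhdsGT hε₀pos] with ε h using h
  have hbound : ∀ ε, 0 < ε → ε ≤ ε₀ → ∀ y ∈ symmShell x ε,
      ‖f y‖ ≤ L * ε ^ (1 - ((N : ℝ) + 2 * s)) := fun ε h h' =>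
    norm_le_on_symmShell hN hs.1 hL hf hx h (hsmall ε h').1 (hsmall ε h').2
  have hfin : ∀ ε, 0 < ε → ε ≤ ε₀ → volume (symmShell x ε) < ⊤ := fun ε h h' =>
    (measure_mono ((symmShell_subset hx h (hsmall ε h').1).trans sdiff_subset)).trans_lt
      measure_closedBall_lt_top
  have hshell : ∀ ε, 0 < ε → ε ≤ ε₀ → IntegrableOn f (symmShell x ε) := fun ε h h' =>
    Measure.integrableOn_of_bounded (hfin ε h h').ne hfm.aestronglyMeasurable
      ((ae_restrict_iff' (measurableSet_symmShell x ε)).2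
        (Eventually.of_forall (hbound ε h h')))
  have hsplit : ∀ ε, {y : EuclideanSpace ℝ (Fin N) | y ≠ 0 ∧ ε < ‖y - x‖} =
      symmExterior x ε ∪ symmShell x ε := by
    intro ε
    have h : symmExterior x ε ⊆ {y | y ≠ 0 ∧ ε < ‖y - x‖} := fun y hy => ⟨hy.1, hy.2.1⟩
    exact (union_sdiff_cancel h).symm
  have hext : ∀ ε, 0 < ε → ε ≤ ε₀ → IntegrableOn f {y | y ≠ 0 ∧ ε < ‖y - x‖} := by
    intro ε h h'
    rw [hsplit]
    exact (hfi ε h).union (hshell ε h h')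
  have houterm : ∀ ε, MeasurableSet {y : EuclideanSpace ℝ (Fin N) | 1 / ε ≤ ‖y - x‖} := fun ε =>
    measurableSet_le (by fun_prop) (by fun_prop)
  have hshell0 : Tendsto (fun ε : ℝ => ∫ y in symmShell x ε, f y) (𝓝[>] (0 : ℝ)) (𝓝 0) := by
    set C := L * (2 * 2 ^ N / ‖x‖ * volume.real (Metric.ball (0 : EuclideanSpace ℝ (Fin N)) 1))
    have hlim : Tendsto (fun ε : ℝ => C * ε ^ (2 - 2 * s)) (𝓝[>] (0 : ℝ)) (𝓝 0) := by
      have h : Tendsto (fun ε : ℝ => ε ^ (2 - 2 * s)) (𝓝[>] (0 : ℝ)) (𝓝 0) := by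
        have h2 : 0 < 2 - 2 * s := by linarith [hs.2]
        have h1 := (Real.continuousAt_rpow_const 0 (2 - 2 * s) (Or.inr h2.le)).tendsto
        rw [Real.zero_rpow h2.ne'] at h1
        exact h1.mono_left nhdsWithin_le_nhds
      simpa using h.const_mul C
    refine squeeze_zero_norm' ?_ hlim
    filter_upwards [hev] with ε hε
    refine (norm_setIntegral_le_of_norm_le_const (hfin ε hε.1 hε.2) (hbound ε hε.1 hε.2)).trans ?_
    have hpow : ε ^ (2 - 2 * s) = ε ^ (1 - ((N : ℝ) + 2 * s)) * ε ^ ((N : ℝ) + 1) := by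
      rw [← Real.rpow_add hε.1]
      ring_nf
    have hv := volume_real_symmShell_le hx hε.1 (hsmall ε hε.2).1
    have hp : 0 ≤ ε ^ (1 - ((N : ℝ) + 2 * s)) := Real.rpow_nonneg hε.1.le _
    calc _ ≤ _ := mul_le_mul_of_nonneg_left hv (mul_nonneg hL hp)
      _ = _ := by rw [hpow]; ring
  have houter0 : Tendsto (fun ε : ℝ =>
      ∫ y in {y | y ≠ 0 ∧ ε < ‖y - x‖} ∩ {y | 1 / ε ≤ ‖y - x‖}, f y) (𝓝[>] (0 : ℝ)) (𝓝 0) := by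
    have hI := hext ε₀ hε₀pos le_rfl
    rw [← integrable_indicator_iff (measurableSet_punctured_exterior x ε₀)] at hI
    have hdct := tendsto_integral_filter_of_dominated_convergence (μ := volume)
      (l := 𝓝[>] (0 : ℝ)) (F := fun (ε : ℝ) =>
        ({y | y ≠ 0 ∧ ε < ‖y - x‖} ∩ {y | 1 / ε ≤ ‖y - x‖}).indicator f)
      (f := fun _ => 0) _ ?_ ?_ hI.norm ?_
    · simp only [integral_zero] at hdct
      refine hdct.congr fun ε => ?_
      rw [integral_indicator ((measurableSet_punctured_exterior x ε).inter (houterm ε))]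
    · exact Eventually.of_forall fun ε => (hfm.indicator
        ((measurableSet_punctured_exterior x ε).inter (houterm ε))).aestronglyMeasurable
    · filter_upwards [hev, Ioc_mem_nhdsGT (show 0 < 1 / (ε₀ + 1) by positivity)] with ε hε hε1
      refine Eventually.of_forall fun y => ?_
      have h1 : ε₀ + 1 ≤ 1 / ε := by
        rw [le_div_iff₀ hε.1, mul_comm, ← le_div_iff₀ (by positivity)]
        exact hε1.2
      rw [norm_indicator_eq_indicator_norm, norm_indicator_eq_indicator_norm]
      refine indicator_le_indicator_of_subset ?_ (fun _ => norm_nonneg _) y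
      rintro y ⟨⟨h0, -⟩, h2⟩
      refine ⟨h0, ?_⟩
      have h2 : 1 / ε ≤ ‖y - x‖ := h2
      linarith
    · refine Eventually.of_forall fun y => ?_
      refine tendsto_const_nhds.congr' ?_
      filter_upwards [Ioc_mem_nhdsGT (show 0 < 1 / (‖y - x‖ + 1) by positivity)] with ε hε
      rw [indicator_of_notMem]
      rintro ⟨-, h⟩
      have h : 1 / ε ≤ ‖y - x‖ := h
      have h1 : ‖y - x‖ + 1 ≤ 1 / ε := by
        rw [le_div_iff₀ hε.1, mul_comm, ← le_div_iff₀ (by positivity)]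
        exact hε.2
      linarith
  have hfinal := hshell0.sub houter0
  rw [sub_zero] at hfinal
  refine hfinal.congr' ?_
  filter_upwards [hev] with ε hε
  have hI := hext ε hε.1 hε.2
  have h1 : ∫ y in {y | y ≠ 0 ∧ ε < ‖y - x‖}, f y =
      (∫ y in symmExterior x ε, f y) + ∫ y in symmShell x ε, f y := by
    rw [hsplit]
    exact setIntegral_union disjoint_sdiff_right (measurableSet_symmShell x ε) (hfi ε hε.1)
      (hshell ε hε.1 hε.2)
  have h2 := integral_inter_add_sdiff (houterm ε) hI
  have h3 : ∫ y in {y | y ≠ 0 ∧ ε < ‖y - x‖} \ {y | 1 / ε ≤ ‖y - x‖}, f y =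
      ∫ y in {y | ε < ‖y - x‖ ∧ ‖y - x‖ < 1 / ε}, f y := by
    have hset : {y : EuclideanSpace ℝ (Fin N) | y ≠ 0 ∧ ε < ‖y - x‖} \ {y | 1 / ε ≤ ‖y - x‖} =
        {y | ε < ‖y - x‖ ∧ ‖y - x‖ < 1 / ε} \ {0} := by
      ext y
      simp only [Set.mem_sdiff, mem_ofPred_eq, not_le, mem_singleton_iff]
      tauto
    rw [hset]
    have : Nontrivial (EuclideanSpace ℝ (Fin N)) := ⟨x, 0, hx⟩
    exact setIntegral_congr_set (sdiff_null_ae_eq_self (measure_singleton _))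
  linarith

lemma integrableOn_one_sub_one_add_rpow {s c : ℝ} (hs : s ∈ Ioo (0 : ℝ) 1) (hc : 0 < c) :
    IntegrableOn (fun t : ℝ => (1 - (1 + t) ^ s) * t ^ (-1 - 2 * s)) (Ioi c) := by
  have h := (integrableOn_Ioi_rpow_of_lt (show -1 - s < -1 by linarith [hs.1]) hc).const_mul
    ((1 / c + 1) ^ s)
  refine h.mono' (by fun_prop :
    Measurable fun t : ℝ => (1 - (1 + t) ^ s) * t ^ (-1 - 2 * s)).aestronglyMeasurable ?_
  rw [ae_restrict_iff' measurableSet_Ioi]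
  refine Eventually.of_forall fun t (ht : c < t) => ?_
  have ht0 : 0 < t := hc.trans ht
  have h1 : 1 ≤ (1 + t) ^ s := Real.one_le_rpow (by linarith) hs.1.le
  have h2 : (1 + t) ^ s ≤ (1 / c + 1) ^ s * t ^ s := by
    rw [← Real.mul_rpow (by positivity) ht0.le]
    refine Real.rpow_le_rpow (by positivity) ?_ hs.1.le
    have : 1 ≤ 1 / c * t := by
      rw [one_div_mul_eq_div, le_div_iff₀ hc]
      linarith
    linarith
  have h3 : t ^ (-1 - s) = t ^ s * t ^ (-1 - 2 * s) := by
    rw [← Real.rpow_add ht0]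
    ring_nf
  rw [norm_mul, Real.norm_of_nonneg (Real.rpow_nonneg ht0.le (-1 - 2 * s)), h3, ← mul_assoc]
  refine mul_le_mul_of_nonneg_right ?_ (Real.rpow_nonneg ht0.le _)
  rw [Real.norm_eq_abs, abs_le]
  constructor <;> linarith

lemma integrableOn_one_sub_max_rpow {s c : ℝ} (hs : s ∈ Ioo (0 : ℝ) 1) (hc : 0 < c) :
    IntegrableOn (fun t : ℝ => (1 - (max (1 - t) 0) ^ s) * t ^ (-1 - 2 * s)) (Ioi c) := by
  have h := integrableOn_Ioi_rpow_of_lt (show -1 - 2 * s < -1 by linarith [hs.1]) hc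
  refine h.mono' (by fun_prop :
    Measurable fun t : ℝ => (1 - (max (1 - t) 0) ^ s) * t ^ (-1 - 2 * s)).aestronglyMeasurable ?_
  rw [ae_restrict_iff' measurableSet_Ioi]
  refine Eventually.of_forall fun t (ht : c < t) => ?_
  have ht0 : 0 < t := hc.trans ht
  have h1 : 0 ≤ (max (1 - t) 0) ^ s := Real.rpow_nonneg (le_max_right _ _) _
  have h2 : (max (1 - t) 0) ^ s ≤ 1 :=
    Real.rpow_le_one (le_max_right _ _) (max_le (by linarith) zero_le_one) hs.1.le
  rw [norm_mul, Real.norm_of_nonneg (Real.rpow_nonneg ht0.le (-1 - 2 * s))]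
  refine mul_le_of_le_one_left (Real.rpow_nonneg ht0.le _) ?_
  rw [Real.norm_eq_abs, abs_le]
  constructor <;> linarith

lemma image_inv_sub_one_Ioo {w : ℝ} (hw : 0 < w) :
    (fun x : ℝ => x⁻¹ - 1) '' Ioo 0 w = Ioi (w⁻¹ - 1) := by
  ext t
  simp only [mem_image, mem_Ioo, mem_Ioi]
  constructor
  · rintro ⟨x, ⟨h0, h1⟩, rfl⟩
    have := (inv_lt_inv₀ hw h0).2 h1
    linarith
  · intro h
    have hw' := inv_pos.2 hw
    have h1 : 0 < t + 1 := by linarith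
    refine ⟨(t + 1)⁻¹, ⟨inv_pos.2 h1, ?_⟩, by simp⟩
    exact inv_lt_of_inv_lt₀ hw (by linarith)

lemma image_one_sub_Ioo (w : ℝ) : (fun x : ℝ => 1 - x) '' Ioo 0 w = Ioo (1 - w) 1 := by
  simp

lemma hasDerivAt_one_sub_rpow_sq {s w : ℝ} (hs : s ∈ Ioo (0 : ℝ) 1) (hw : w ∈ Ioo (0 : ℝ) 1) :
    HasDerivAt (fun w : ℝ => (1 - w ^ s) ^ 2 * (1 - w) ^ (-2 * s) / (2 * s))
      ((1 - w ^ s) * (1 - w ^ (s - 1)) * (1 - w) ^ (-1 - 2 * s)) w := by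
  have h0 := hw.1
  have h1 : 0 < 1 - w := by linarith [hw.2]
  have hs0 := hs.1
  have hA := (((Real.hasDerivAt_rpow_const (x := w) (p := s) (Or.inl h0.ne')).const_sub 1).pow 2)
  have hB := ((hasDerivAt_id w).const_sub 1).rpow_const (p := -2 * s) (Or.inl h1.ne')
  refine ((hA.mul hB).div_const (2 * s)).congr_deriv ?_
  have e1 : (1 - w) ^ (-2 * s) = (1 - w) * (1 - w) ^ (-1 - 2 * s) := by
    rw [← Real.rpow_one_add' h1.le (by linarith)]
    ring_nf
  have e2 : (1 - w) ^ (-2 * s - 1) = (1 - w) ^ (-1 - 2 * s) := by ring_nf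
  have e3 : w ^ s = w * w ^ (s - 1) := by
    rw [← Real.rpow_one_add' h0.le (by linarith)]
    ring_nf
  simp only [id, Pi.pow_apply, e1, e2]
  rw [e3]
  field_simp
  push_cast
  ring

/-- Inversion `t ↦ 1 / (1 + t)` on the half-line combines the two one-sided integrals into the
integral of a derivative. -/
lemma integral_Ioi_add_integral_Ioi {s w : ℝ} (hs : s ∈ Ioo (0 : ℝ) 1) (hw : w ∈ Ioo (0 : ℝ) 1) :
    (∫ t in Ioi (w⁻¹ - 1), (1 - (1 + t) ^ s) * t ^ (-1 - 2 * s)) +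
      ∫ t in Ioi (1 - w), (1 - (max (1 - t) 0) ^ s) * t ^ (-1 - 2 * s) =
    (1 - w ^ s) ^ 2 * (1 - w) ^ (-2 * s) / (2 * s) := by
  have hs0 := hs.1
  have hw0 := hw.1
  have h1w : 0 < 1 - w := by linarith [hw.2]
  have hc : 0 < w⁻¹ - 1 := by linarith [(one_lt_inv₀ hw0).2 hw.2]
  have ha := integrableOn_one_sub_one_add_rpow hs hc
  have hb := integrableOn_one_sub_max_rpow hs h1w
  have hb1 : ∫ t in Ioi (1 - w), (1 - (max (1 - t) 0) ^ s) * t ^ (-1 - 2 * s) =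
      (∫ t in Ioo (1 - w) 1, (1 - (max (1 - t) 0) ^ s) * t ^ (-1 - 2 * s)) + 1 / (2 * s) := by
    rw [← Ioc_union_Ioi_eq_Ioi (show 1 - w ≤ 1 by linarith),
      setIntegral_union Ioc_disjoint_Ioi_same measurableSet_Ioi
        (hb.mono_set Ioc_subset_Ioi_self) (hb.mono_set (Ioi_subset_Ioi (by linarith))),
      integral_Ioc_eq_integral_Ioo]
    congr 1
    rw [setIntegral_congr_fun (g := fun t : ℝ => t ^ (-1 - 2 * s)) measurableSet_Ioi,
      integral_Ioi_rpow_of_lt (by linarith) one_pos]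
    · rw [Real.one_rpow]
      have : -1 - 2 * s + 1 ≠ 0 := by linarith
      field_simp
      ring
    · intro t (ht : 1 < t)
      simp only
      rw [max_eq_right (by linarith), Real.zero_rpow hs0.ne']
      ring
  have hinj1 : InjOn (fun x : ℝ => x⁻¹ - 1) (Ioo 0 w) := fun x _ y _ h => by
    simpa using h
  have hinj2 : InjOn (fun x : ℝ => 1 - x) (Ioo 0 w) := fun x _ y _ h => by
    simpa using h
  have hd1 : ∀ x ∈ Ioo (0 : ℝ) w, HasDerivWithinAt (fun x : ℝ => x⁻¹ - 1) (-(x ^ 2)⁻¹) (Ioo 0 w) x :=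
    fun x hx => ((hasDerivAt_inv hx.1.ne').sub_const 1).hasDerivWithinAt
  have hd2 : ∀ x ∈ Ioo (0 : ℝ) w, HasDerivWithinAt (fun x : ℝ => 1 - x) (-1) (Ioo 0 w) x :=
    fun x _ => ((hasDerivAt_id x).const_sub 1).hasDerivWithinAt
  have hb' := hb.mono_set (Ioo_subset_Ioi_self : Ioo (1 - w) 1 ⊆ _)
  rw [hb1]
  rw [← image_inv_sub_one_Ioo hw0] at ha ⊢
  rw [← image_one_sub_Ioo w] at hb' ⊢
  rw [integrableOn_image_iff_integrableOn_abs_deriv_smul measurableSet_Ioo hd1 hinj1] at ha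
  rw [integrableOn_image_iff_integrableOn_abs_deriv_smul measurableSet_Ioo hd2 hinj2] at hb'
  rw [integral_image_eq_integral_abs_deriv_smul measurableSet_Ioo hd1 hinj1,
    integral_image_eq_integral_abs_deriv_smul measurableSet_Ioo hd2 hinj2, ← add_assoc,
    ← integral_add ha hb']
  have hcongr : EqOn (fun x : ℝ => |(-(x ^ 2)⁻¹)| •
        ((1 - (1 + (x⁻¹ - 1)) ^ s) * (x⁻¹ - 1) ^ (-1 - 2 * s)) +
      |(-1 : ℝ)| • ((1 - (max (1 - (1 - x)) 0) ^ s) * (1 - x) ^ (-1 - 2 * s)))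
      (fun x => (1 - x ^ s) * (1 - x ^ (s - 1)) * (1 - x) ^ (-1 - 2 * s)) (Ioo 0 w) := by
    intro x hx
    have hx0 := hx.1
    have hx1 : 0 < 1 - x := by linarith [hx.2]
    have e1 : x⁻¹ - 1 = x⁻¹ * (1 - x) := by field_simp
    have e2 : x⁻¹ ^ (-1 - 2 * s) = x ^ 2 * (x ^ (s - 1) * x ^ s) := by
      rw [Real.inv_rpow hx0.le, ← Real.rpow_neg hx0.le, ← Real.rpow_natCast x 2,
        ← Real.rpow_add hx0, ← Real.rpow_add hx0]
      push_cast
      ring_nf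
    have e3 : x⁻¹ ^ s = (x ^ s)⁻¹ := Real.inv_rpow hx0.le s
    have e4 : x ^ s ≠ 0 := (Real.rpow_pos_of_pos hx0 s).ne'
    simp only [smul_eq_mul]
    rw [abs_neg, abs_neg, abs_one, abs_of_pos (by positivity), add_sub_cancel, sub_sub_cancel,
      max_eq_left hx0.le, e1, Real.mul_rpow (by positivity) hx1.le, e2, e3]
    field_simp
    ring
  rw [setIntegral_congr_fun measurableSet_Ioo hcongr]
  have hI := (ha.add hb').congr_fun hcongr measurableSet_Ioo
  have hF := intervalIntegral.integral_eq_sub_of_hasDerivAt_of_le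
    (f := fun w : ℝ => (1 - w ^ s) ^ 2 * (1 - w) ^ (-2 * s) / (2 * s))
    (f' := fun x => (1 - x ^ s) * (1 - x ^ (s - 1)) * (1 - x) ^ (-1 - 2 * s)) hw0.le ?_
    (fun x hx => hasDerivAt_one_sub_rpow_sq hs ⟨hx.1, hx.2.trans hw.2⟩) ?_
  · rw [intervalIntegral.integral_of_le hw0.le, integral_Ioc_eq_integral_Ioo] at hF
    rw [hF]
    simp [Real.zero_rpow hs0.ne']
  · intro x hx
    have hx1 : 1 - x ≠ 0 := by linarith [hx.2, hw.2]
    refine ContinuousAt.continuousWithinAt ?_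
    have c1 := Real.continuousAt_rpow_const x s (Or.inr hs0.le)
    have c2 : ContinuousAt (fun x : ℝ => (1 - x) ^ (-2 * s)) x :=
      ContinuousAt.rpow_const (by fun_prop) (Or.inl hx1)
    exact ((((continuousAt_const.sub c1).pow 2).mul c2).div_const _)
  · rw [intervalIntegrable_iff_integrableOn_Ioo_of_le hw0.le]
    exact hI

lemma abs_integral_Ioi_second_difference_le {s w : ℝ} (hs : s ∈ Ioo (0 : ℝ) 1)
    (hw : w ∈ Ico (1 / 2 : ℝ) 1) :
    |∫ t in Ioi (1 - w), (2 - (1 + t) ^ s - (max (1 - t) 0) ^ s) * t ^ (-1 - 2 * s)| ≤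
      (1 / (2 * s) + 2) * (1 - w) ^ (2 - 2 * s) := by
  have hs0 := hs.1
  have hw0 : 0 < w := by linarith [hw.1]
  have h1w : 0 < 1 - w := by linarith [hw.2]
  have hle : 1 - w ≤ w⁻¹ - 1 := by
    have : w⁻¹ - 1 - (1 - w) = (1 - w) ^ 2 / w := by field_simp
    have : 0 ≤ (1 - w) ^ 2 / w := by positivity
    linarith
  have ha := integrableOn_one_sub_one_add_rpow hs h1w
  have hb := integrableOn_one_sub_max_rpow hs h1w
  have key := integral_Ioi_add_integral_Ioi hs ⟨hw0, hw.2⟩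
  have hsum : ∫ t in Ioi (1 - w), (2 - (1 + t) ^ s - (max (1 - t) 0) ^ s) * t ^ (-1 - 2 * s) =
      (∫ t in Ioi (1 - w), (1 - (1 + t) ^ s) * t ^ (-1 - 2 * s)) +
      ∫ t in Ioi (1 - w), (1 - (max (1 - t) 0) ^ s) * t ^ (-1 - 2 * s) := by
    rw [← integral_add ha hb]
    congr 1
    ext t
    ring
  rw [← Ioc_union_Ioi_eq_Ioi hle, setIntegral_union Ioc_disjoint_Ioi_same measurableSet_Ioi
    (ha.mono_set Ioc_subset_Ioi_self) (ha.mono_set (Ioi_subset_Ioi hle)), add_assoc,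
    Ioc_union_Ioi_eq_Ioi hle, key] at hsum
  have hpow : (1 - w) ^ (2 - 2 * s) = (1 - w) ^ 2 * (1 - w) ^ (-2 * s) := by
    rw [← Real.rpow_natCast (1 - w) 2, ← Real.rpow_add h1w]
    push_cast
    ring_nf
  have hK : 0 < (1 - w) ^ (-2 * s) := Real.rpow_pos_of_pos h1w _
  have hmid : |∫ t in Ioc (1 - w) (w⁻¹ - 1), (1 - (1 + t) ^ s) * t ^ (-1 - 2 * s)| ≤
      2 * (1 - w) ^ (2 - 2 * s) := by
    have h := norm_setIntegral_le_of_norm_le_const (μ := volume) (s := Ioc (1 - w) (w⁻¹ - 1))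
      (f := fun t : ℝ => (1 - (1 + t) ^ s) * t ^ (-1 - 2 * s)) (C := (1 - w) ^ (-2 * s))
      measure_Ioc_lt_top ?_
    · rw [Real.norm_eq_abs, Real.volume_real_Ioc_of_le hle] at h
      refine h.trans ?_
      have e : w⁻¹ - 1 - (1 - w) = (1 - w) ^ 2 * w⁻¹ := by field_simp
      have : w⁻¹ ≤ 2 := by
        rw [inv_le_comm₀ hw0 two_pos]
        linarith [hw.1]
      rw [e, hpow]
      have : (1 - w) ^ 2 * w⁻¹ ≤ (1 - w) ^ 2 * 2 := by gcongr
      nlinarith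
    · intro t ht
      have ht0 : 0 < t := h1w.trans ht.1
      have b1 : 1 ≤ (1 + t) ^ s := Real.one_le_rpow (by linarith) hs0.le
      have b2 : (1 + t) ^ s ≤ 1 + s * t :=
        rpow_one_add_le_one_add_mul_self (by linarith) hs0.le hs.2.le
      have hk : 0 < t ^ (-1 - 2 * s) := Real.rpow_pos_of_pos ht0 _
      have b3 : s * t ≤ t := mul_le_of_le_one_left ht0.le hs.2.le
      have b4 : |1 - (1 + t) ^ s| ≤ t := by
        rw [abs_le]
        constructor <;> linarith
      have e : t * t ^ (-1 - 2 * s) = t ^ (-2 * s) := by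
        rw [← Real.rpow_one_add' ht0.le (by linarith)]
        ring_nf
      rw [norm_mul, Real.norm_of_nonneg hk.le, Real.norm_eq_abs]
      calc _ ≤ t * t ^ (-1 - 2 * s) := by gcongr
        _ = t ^ (-2 * s) := e
        _ ≤ _ := Real.rpow_le_rpow_of_nonpos h1w ht.1.le (by linarith)
  have hF : |(1 - w ^ s) ^ 2 * (1 - w) ^ (-2 * s) / (2 * s)| ≤
      1 / (2 * s) * (1 - w) ^ (2 - 2 * s) := by
    have b1 : w ≤ w ^ s := by
      simpa using Real.rpow_le_rpow_of_exponent_ge hw0 hw.2.le hs.2.le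
    have b2 : w ^ s ≤ 1 := Real.rpow_le_one hw0.le hw.2.le hs0.le
    rw [abs_of_nonneg (by positivity), hpow, one_div_mul_eq_div]
    have : (1 - w ^ s) ^ 2 ≤ (1 - w) ^ 2 := by
      apply pow_le_pow_left₀ <;> linarith
    gcongr
  rw [hsum]
  refine (abs_add_le _ _).trans ?_
  linarith

/-- In dimension one, `t ↦ (t₊) ^ s` is `s`-harmonic at `1`. -/
lemma integral_Ioi_second_difference_eq_zero {s : ℝ} (hs : s ∈ Ioo (0 : ℝ) 1) :
    ∫ t in Ioi (0 : ℝ), (2 - (1 + t) ^ s - (max (1 - t) 0) ^ s) * t ^ (-1 - 2 * s) = 0 := by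
  set g : ℝ → ℝ := fun t => (2 - (1 + t) ^ s - (max (1 - t) 0) ^ s) * t ^ (-1 - 2 * s) with hg
  by_cases hI : IntegrableOn g (Ioi 0)
  swap
  · exact integral_undef hI
  have hδ : Tendsto (fun n : ℕ => 1 / ((n : ℝ) + 1)) atTop (𝓝 0) :=
    tendsto_one_div_add_atTop_nhds_zero_nat
  have hU : ⋃ n : ℕ, Ioi (1 / ((n : ℝ) + 1)) = Ioi 0 := by
    ext t
    simp only [mem_iUnion, mem_Ioi]
    constructor
    · rintro ⟨n, hn⟩
      exact lt_trans (by positivity) hn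
    · exact exists_nat_one_div_lt
  have hmono : Monotone fun n : ℕ => Ioi (1 / ((n : ℝ) + 1)) := fun m n h =>
    Ioi_subset_Ioi (one_div_le_one_div_of_le (by positivity) (by gcongr))
  have h1 := tendsto_setIntegral_of_monotone (μ := volume) (f := g)
    (fun n : ℕ => (measurableSet_Ioi : MeasurableSet (Ioi (1 / ((n : ℝ) + 1))))) hmono
    (by rwa [hU])
  rw [hU] at h1
  refine tendsto_nhds_unique h1 ?_
  have h2s : 0 < 2 - 2 * s := by linarith [hs.2]
  have hlim : Tendsto (fun n : ℕ => (1 / (2 * s) + 2) * (1 / ((n : ℝ) + 1)) ^ (2 - 2 * s)) atTop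
      (𝓝 0) := by
    have h := (hδ.rpow_const (p := 2 - 2 * s) (Or.inr h2s.le)).const_mul (1 / (2 * s) + 2)
    rwa [Real.zero_rpow h2s.ne', mul_zero] at h
  refine squeeze_zero_norm' ?_ hlim
  filter_upwards [eventually_ge_atTop 1] with n hn
  have hn' : (1 : ℝ) ≤ n := by exact_mod_cast hn
  have hle : 1 / ((n : ℝ) + 1) ≤ 1 / 2 := one_div_le_one_div_of_le two_pos (by linarith)
  have hpos : 0 < 1 / ((n : ℝ) + 1) := by positivity
  have := abs_integral_Ioi_second_difference_le hs (w := 1 - 1 / ((n : ℝ) + 1))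
    ⟨by linarith, by linarith⟩
  rwa [sub_sub_cancel] at this

lemma integral_Ioi_second_difference_linear_eq_zero {s a : ℝ} (hs : s ∈ Ioo (0 : ℝ) 1) (ha : 0 < a)
    (c : ℝ) :
    ∫ r in Ioi (0 : ℝ), (2 * a ^ s - (max (a + r * c) 0) ^ s - (max (a - r * c) 0) ^ s) *
      r ^ (-1 - 2 * s) = 0 := by
  rcases eq_or_ne c 0 with rfl | hc
  · have : ∀ r : ℝ, (2 * a ^ s - (max (a + r * 0) 0) ^ s - (max (a - r * 0) 0) ^ s) *
        r ^ (-1 - 2 * s) = 0 := by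
      intro r
      rw [mul_zero, add_zero, sub_zero, max_eq_left ha.le]
      ring
    simp only [this, integral_zero]
  have hc' : 0 < |c| := abs_pos.2 hc
  set b := |c| / a with hb
  have hb0 : 0 < b := by positivity
  have h := integral_comp_mul_left_Ioi
    (fun t => (2 - (1 + t) ^ s - (max (1 - t) 0) ^ s) * t ^ (-1 - 2 * s)) 0 hb0
  rw [mul_zero, integral_Ioi_second_difference_eq_zero hs, smul_zero] at h
  have h2 := congrArg (fun y => a ^ s * b ^ (1 + 2 * s) * y) h
  simp only [mul_zero] at h2
  rw [← integral_const_mul] at h2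
  refine Eq.trans ?_ h2
  refine setIntegral_congr_fun measurableSet_Ioi fun r (hr : 0 < r) => ?_
  have e1 : (b * r) ^ (-1 - 2 * s) = (b ^ (1 + 2 * s))⁻¹ * r ^ (-1 - 2 * s) := by
    rw [Real.mul_rpow hb0.le hr.le, ← Real.rpow_neg hb0.le]
    ring_nf
  have hbne : b ^ (1 + 2 * s) ≠ 0 := (Real.rpow_pos_of_pos hb0 _).ne'
  have e2 : (max (a + r * c) 0) ^ s + (max (a - r * c) 0) ^ s =
      a ^ s * ((1 + b * r) ^ s + (max (1 - b * r) 0) ^ s) := by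
    have e3 : a ^ s * (1 + b * r) ^ s = (max (a + r * |c|) 0) ^ s := by
      rw [← Real.mul_rpow ha.le (by positivity), max_eq_left (by positivity), hb]
      congr 1
      field_simp
    have e4 : a ^ s * (max (1 - b * r) 0) ^ s = (max (a - r * |c|) 0) ^ s := by
      rw [← Real.mul_rpow ha.le (le_max_right _ _), mul_max_of_nonneg _ _ ha.le, mul_zero, hb]
      congr 2
      field_simp
    rw [mul_add, e3, e4]
    rcases abs_cases c with ⟨h, -⟩ | ⟨h, -⟩ <;> rw [h]
    rw [mul_neg, sub_neg_eq_add, ← sub_eq_add_neg, add_comm]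
  rw [e1, sub_sub, e2, sub_sub]
  field_simp

lemma abs_second_difference_le_sq {s t : ℝ} (hs : s ∈ Ioo (0 : ℝ) 1) (ht : |t| ≤ 1) :
    |2 - (1 + t) ^ s - (1 - t) ^ s| ≤ 2 * t ^ 2 := by
  obtain ⟨h1, h2⟩ := abs_le.1 ht
  have hp : 0 ≤ (1 + t) ^ s := Real.rpow_nonneg (by linarith) _
  have hq : 0 ≤ (1 - t) ^ s := Real.rpow_nonneg (by linarith) _
  have hp1 : (1 + t) ^ s ≤ 1 + s * t :=
    rpow_one_add_le_one_add_mul_self h1 hs.1.le hs.2.le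
  have hq1 : (1 - t) ^ s ≤ 1 + s * (-t) := by
    have := rpow_one_add_le_one_add_mul_self (s := -t) (by linarith) hs.1.le hs.2.le
    rwa [← sub_eq_add_neg] at this
  have ht2 : t ^ 2 ≤ 1 := by nlinarith
  have hpq : (1 - t ^ 2) ^ 2 ≤ (1 + t) ^ s * (1 - t) ^ s := by
    rw [← Real.mul_rpow (by linarith) (by linarith), show (1 + t) * (1 - t) = 1 - t ^ 2 by ring]
    have h0 : 0 ≤ 1 - t ^ 2 := by linarith
    calc (1 - t ^ 2) ^ 2 ≤ 1 - t ^ 2 := by nlinarith [sq_nonneg t]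
      _ ≤ (1 - t ^ 2) ^ s := by
        rcases h0.eq_or_lt with h | h
        · rw [← h]
          exact Real.rpow_nonneg le_rfl _
        · simpa using Real.rpow_le_rpow_of_exponent_ge h (by nlinarith [sq_nonneg t]) hs.2.le
  have hlow : 2 * (1 - t ^ 2) ≤ (1 + t) ^ s + (1 - t) ^ s := by
    refine (sq_le_sq₀ (by linarith) (by positivity)).1 ?_
    nlinarith [sq_nonneg ((1 + t) ^ s - (1 - t) ^ s)]
  rw [abs_le]
  constructor <;> nlinarith [sq_nonneg t]

lemma abs_second_difference_le_near {s a c ρ : ℝ} (hs : s ∈ Ioo (0 : ℝ) 1) (ha : 0 < a)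
    (hc : |c| ≤ ρ) (hρ : ρ ≤ a) :
    |2 * a ^ s - (max (a + c) 0) ^ s - (max (a - c) 0) ^ s| ≤ 2 * a ^ s / a ^ 2 * ρ ^ 2 := by
  obtain ⟨h1, h2⟩ := abs_le.1 (hc.trans hρ)
  have ht : |c / a| ≤ 1 := by
    rw [abs_div, abs_of_pos ha, div_le_one ha]
    exact hc.trans hρ
  obtain ⟨h3, h4⟩ := abs_le.1 ht
  rw [max_eq_left (by linarith), max_eq_left (by linarith),
    show a + c = a * (1 + c / a) by field_simp, show a - c = a * (1 - c / a) by field_simp,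
    Real.mul_rpow ha.le (by linarith), Real.mul_rpow ha.le (by linarith),
    show 2 * a ^ s - a ^ s * (1 + c / a) ^ s - a ^ s * (1 - c / a) ^ s =
      a ^ s * (2 - (1 + c / a) ^ s - (1 - c / a) ^ s) by ring, abs_mul,
    abs_of_pos (Real.rpow_pos_of_pos ha s)]
  have hsq : c ^ 2 ≤ ρ ^ 2 := sq_le_sq' (by linarith [abs_le.1 hc]) (abs_le.1 hc).2
  calc _ ≤ a ^ s * (2 * (c / a) ^ 2) :=
        mul_le_mul_of_nonneg_left (abs_second_difference_le_sq hs ht) (by positivity)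
    _ = 2 * a ^ s / a ^ 2 * c ^ 2 := by field_simp
    _ ≤ _ := by gcongr

lemma abs_second_difference_le_far {s a c ρ : ℝ} (hs : s ∈ Ioo (0 : ℝ) 1) (ha : 0 < a)
    (hc : |c| ≤ ρ) (hρ : a ≤ ρ) :
    |2 * a ^ s - (max (a + c) 0) ^ s - (max (a - c) 0) ^ s| ≤ 4 * ρ ^ s := by
  obtain ⟨h1, h2⟩ := abs_le.1 hc
  have hρ0 : 0 < ρ := ha.trans_le hρ
  have h2s : (2 : ℝ) ^ s ≤ 2 := by
    simpa using Real.rpow_le_rpow_of_exponent_le one_le_two hs.2.le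
  have hr : 0 ≤ ρ ^ s := by positivity
  have hb : ∀ b, b ≤ 2 * ρ → (max b 0) ^ s ≤ 2 * ρ ^ s := fun b hb => by
    calc (max b 0) ^ s ≤ (2 * ρ) ^ s :=
          Real.rpow_le_rpow (le_max_right _ _) (max_le hb (by positivity)) hs.1.le
      _ = 2 ^ s * ρ ^ s := Real.mul_rpow two_pos.le hρ0.le
      _ ≤ _ := by gcongr
  have hP := hb (a + c) (by linarith)
  have hQ := hb (a - c) (by linarith)
  have hP0 : 0 ≤ (max (a + c) 0) ^ s := Real.rpow_nonneg (le_max_right _ _) _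
  have hQ0 : 0 ≤ (max (a - c) 0) ^ s := Real.rpow_nonneg (le_max_right _ _) _
  have hA : a ^ s ≤ ρ ^ s := Real.rpow_le_rpow ha.le hρ hs.1.le
  have hA0 : 0 ≤ a ^ s := by positivity
  rw [abs_le]
  constructor <;> linarith

/-- The symmetric second difference of `halfPow` at `x`, times the fractional kernel. -/
def halfPowSecondDiff (N : ℕ) [NeZero N] (s : ℝ) (x z : EuclideanSpace ℝ (Fin N)) : ℝ :=
  (2 * halfPow N s x - halfPow N s (x + z) - halfPow N s (x - z)) / ‖z‖ ^ ((N : ℝ) + 2 * s)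

lemma measurable_halfPowSecondDiff {N : ℕ} [NeZero N] (s : ℝ) (x : EuclideanSpace ℝ (Fin N)) :
    Measurable (halfPowSecondDiff N s x) := by
  have := measurable_halfPow (N := N) s
  unfold halfPowSecondDiff
  fun_prop

lemma integrable_halfPowSecondDiff {N : ℕ} [NeZero N] {s : ℝ} (hs : s ∈ Ioo (0 : ℝ) 1)
    {x : EuclideanSpace ℝ (Fin N)} (hx : 0 < x 0) : Integrable (halfPowSecondDiff N s x) := by
  have hN : 0 < N := Nat.pos_of_ne_zero (NeZero.ne N)
  have hx0 : halfPow N s x = (x 0) ^ s := by rw [halfPow, max_eq_left hx.le]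
  have hmeas := (measurable_halfPowSecondDiff s x).aestronglyMeasurable (μ := volume)
  have hc : ∀ z : EuclideanSpace ℝ (Fin N), |z 0| ≤ ‖z‖ := fun z => PiLp.norm_apply_le z 0
  have hnear : IntegrableOn (halfPowSecondDiff N s x) {z | ‖z‖ ≤ x 0} := by
    have h := integrableOn_norm_rpow_closedBall hN (q := 2 - 2 * s) (a := x 0)
      (by linarith [hs.2])
    refine (h.const_mul (2 * (x 0) ^ s / (x 0) ^ 2)).mono' hmeas.restrict ?_
    rw [ae_restrict_iff' (measurableSet_le (by fun_prop) (by fun_prop))]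
    refine Eventually.of_forall fun z (hz : ‖z‖ ≤ x 0) => ?_
    have hb := abs_second_difference_le_near hs hx (hc z) hz
    rcases eq_or_ne z 0 with rfl | hz0
    · rw [halfPowSecondDiff, add_zero, sub_zero, two_mul, add_sub_cancel_right, sub_self, zero_div,
        norm_zero]
      positivity
    have hz' : 0 < ‖z‖ := norm_pos_iff.2 hz0
    rw [halfPowSecondDiff, hx0, norm_div, Real.norm_eq_abs, Real.norm_of_nonneg (by positivity),
      div_le_iff₀ (by positivity), mul_assoc, ← Real.rpow_add hz']
    refine hb.trans (le_of_eq ?_)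
    rw [← Real.rpow_natCast ‖z‖ 2]
    congr 2
    push_cast
    ring
  have hfar : IntegrableOn (halfPowSecondDiff N s x) {z | x 0 < ‖z‖} := by
    have h := integrableOn_norm_rpow_exterior hN hs.1 hx
    refine (h.const_mul 4).mono' hmeas.restrict ?_
    rw [ae_restrict_iff' (measurableSet_lt (by fun_prop) (by fun_prop))]
    refine Eventually.of_forall fun z (hz : x 0 < ‖z‖) => ?_
    have hb := abs_second_difference_le_far hs hx (hc z) hz.le
    have hz' : 0 < ‖z‖ := hx.trans hz
    rw [halfPowSecondDiff, hx0, norm_div, Real.norm_eq_abs, Real.norm_of_nonneg (by positivity),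
      div_le_iff₀ (by positivity), mul_assoc, ← Real.rpow_add hz']
    refine hb.trans (le_of_eq ?_)
    congr 2
    ring
  rw [← integrableOn_univ]
  refine (hnear.union hfar).mono_set fun z _ => ?_
  exact le_or_gt ‖z‖ (x 0)

/-- If the integrals along all rays vanish, so does the integral. -/
lemma integral_eq_zero_of_forall_ray {N : ℕ} (hN : 0 < N) {f : EuclideanSpace ℝ (Fin N) → ℝ}
    (hf : Integrable f)
    (h : ∀ w : EuclideanSpace ℝ (Fin N), ‖w‖ = 1 →
      ∫ r in Ioi (0 : ℝ), r ^ (N - 1) * f (r • w) = 0) : ∫ x, f x = 0 := by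
  have : Nontrivial (EuclideanSpace ℝ (Fin N)) := by
    apply Module.nontrivial_of_finrank_pos (R := ℝ)
    simpa using hN
  set μ : Measure (EuclideanSpace ℝ (Fin N)) := volume
  set g : Metric.sphere (0 : EuclideanSpace ℝ (Fin N)) 1 × Ioi (0 : ℝ) → ℝ :=
    fun p => f (p.2.1 • p.1.1)
  have hcomp : ∀ x : ({0}ᶜ : Set (EuclideanSpace ℝ (Fin N))),
      g (homeomorphUnitSphereProd _ x) = f x := by
    intro x
    have hx : ‖x.1‖ ≠ 0 := norm_ne_zero_iff.2 x.2
    simp [g, smul_smul, hx]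
  have hmp := μ.measurePreserving_homeomorphUnitSphereProd
  have hemb := (homeomorphUnitSphereProd (EuclideanSpace ℝ (Fin N))).measurableEmbedding
  have h1 : ∫ x, f x = ∫ p, g p ∂(μ.toSphere.prod
      (.volumeIoiPow (Module.finrank ℝ (EuclideanSpace ℝ (Fin N)) - 1))) := by
    rw [← hmp.integral_comp hemb]
    simp_rw [hcomp]
    rw [integral_subtype_comap (measurableSet_singleton _).compl f, restrict_compl_singleton]
  have h2 : Integrable g (μ.toSphere.prod
      (.volumeIoiPow (Module.finrank ℝ (EuclideanSpace ℝ (Fin N)) - 1))) := by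
    rw [← hmp.integrable_comp_emb hemb]
    have he : g ∘ (homeomorphUnitSphereProd (EuclideanSpace ℝ (Fin N))) = f ∘ Subtype.val :=
      funext hcomp
    rw [he, ← integrableOn_iff_comap_subtypeVal (measurableSet_singleton _).compl]
    exact hf.integrableOn
  rw [h1, integral_prod g h2]
  refine integral_eq_zero_of_ae (Eventually.of_forall fun w => ?_)
  have hw := h w.1 (by simp)
  simp only [Measure.volumeIoiPow, ENNReal.ofReal, Pi.zero_apply]
  rw [integral_withDensity_eq_integral_smul
    (measurable_subtype_coe.pow_const _).real_toNNReal,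
    integral_subtype_comap measurableSet_Ioi fun a : ℝ => Real.toNNReal
      (a ^ (Module.finrank ℝ (EuclideanSpace ℝ (Fin N)) - 1)) • f (a • w.1)]
  refine Eq.trans ?_ hw
  refine setIntegral_congr_fun measurableSet_Ioi fun r (hr : 0 < r) => ?_
  rw [NNReal.smul_def, Real.coe_toNNReal _ (pow_nonneg hr.le _), finrank_euclideanSpace_fin,
    smul_eq_mul]

lemma integral_halfPowSecondDiff {N : ℕ} [NeZero N] {s : ℝ} (hs : s ∈ Ioo (0 : ℝ) 1)
    {x : EuclideanSpace ℝ (Fin N)} (hx : 0 < x 0) : ∫ z, halfPowSecondDiff N s x z = 0 := by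
  have hN : 0 < N := Nat.pos_of_ne_zero (NeZero.ne N)
  refine integral_eq_zero_of_forall_ray hN (integrable_halfPowSecondDiff hs hx) fun w hw => ?_
  refine Eq.trans ?_ (integral_Ioi_second_difference_linear_eq_zero hs hx (w 0))
  refine setIntegral_congr_fun measurableSet_Ioi fun r (hr : 0 < r) => ?_
  have e1 : r ^ (-1 - 2 * s) = r ^ (N - 1) * (r ^ ((N : ℝ) + 2 * s))⁻¹ := by
    rw [← Real.rpow_neg hr.le, ← Real.rpow_natCast r (N - 1), ← Real.rpow_add hr,
      Nat.cast_sub (by omega)]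
    congr 1
    push_cast
    ring
  simp only [halfPowSecondDiff, halfPow, norm_smul, hw, mul_one, Real.norm_of_nonneg hr.le,
    PiLp.add_apply, PiLp.sub_apply, PiLp.smul_apply, smul_eq_mul]
  rw [e1, max_eq_left hx.le]
  ring

lemma pvInt_eq {N : ℕ} (s : ℝ) (g : EuclideanSpace ℝ (Fin N) → ℝ)
    (x : EuclideanSpace ℝ (Fin N)) (ε : ℝ) :
    pvInt N s g x ε = ∫ y in {y | ε < ‖y - x‖ ∧ ‖y - x‖ < 1 / ε}, fracKernel N s g x y := by
  have hm : MeasurableSet {y : EuclideanSpace ℝ (Fin N) | ε < ‖y - x‖ ∧ ‖y - x‖ < 1 / ε} :=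
    (measurable_norm.comp (measurable_id.sub_const x)) measurableSet_Ioo
  have hm' : MeasurableSet (annulus N ε) := measurable_norm measurableSet_Ioo
  rw [pvInt, ← integral_indicator hm, ← integral_indicator hm',
    ← integral_add_left_eq_self (μ := volume)
      ({y | ε < ‖y - x‖ ∧ ‖y - x‖ < 1 / ε}.indicator (fracKernel N s g x)) x]
  congr 1
  ext z
  simp [indicator, annulus, fracKernel]

lemma measurable_fracKernel {N : ℕ} (s : ℝ) {g : EuclideanSpace ℝ (Fin N) → ℝ}
    (hg : Measurable g) (x : EuclideanSpace ℝ (Fin N)) : Measurable (fracKernel N s g x) := by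
  unfold fracKernel
  fun_prop

lemma integrableOn_fracKernel_halfPow {N : ℕ} [NeZero N] {s : ℝ} (hs : s ∈ Ioo (0 : ℝ) 1)
    (x : EuclideanSpace ℝ (Fin N)) {ε : ℝ} (hε : 0 < ε) :
    IntegrableOn (fracKernel N s (halfPow N s) x) {y | ε < ‖y - x‖} := by
  have h1 := integrableOn_kernel_exterior (Nat.pos_of_ne_zero (NeZero.ne N)) hs.1 x hε
  have h2 := integrableOn_halfPow_exterior hs x hε
  refine ((h1.const_mul (halfPow N s x)).sub h2).congr (Eventually.of_forall fun y => ?_)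
  simp only [fracKernel, Pi.sub_apply]
  ring

/-- The function `(y₁)₊ ^ s` is `s`-harmonic in the half-space. -/
lemma tendsto_pvInt_halfPow {N : ℕ} [NeZero N] {s : ℝ} (hs : s ∈ Ioo (0 : ℝ) 1)
    {x : EuclideanSpace ℝ (Fin N)} (hx : 0 < x 0) :
    Tendsto (pvInt N s (halfPow N s) x) (𝓝[>] (0 : ℝ)) (𝓝 0) := by
  have hm : ∀ ε, MeasurableSet (annulus N ε) := fun ε => measurable_norm measurableSet_Ioo
  have hI := integrable_halfPowSecondDiff hs hx
  have hlim : Tendsto (fun ε => ∫ z in annulus N ε, halfPowSecondDiff N s x z) (𝓝[>] (0 : ℝ))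
      (𝓝 0) := by
    have hdct := tendsto_integral_filter_of_dominated_convergence (μ := volume)
      (l := 𝓝[>] (0 : ℝ)) (F := fun (ε : ℝ) => (annulus N ε).indicator (halfPowSecondDiff N s x))
      (f := halfPowSecondDiff N s x) _ ?_ ?_ hI.norm ?_
    · rw [integral_halfPowSecondDiff hs hx] at hdct
      exact hdct.congr fun ε => integral_indicator (hm ε)
    · exact Eventually.of_forall fun ε =>
        ((measurable_halfPowSecondDiff s x).indicator (hm ε)).aestronglyMeasurable
    · exact Eventually.of_forall fun ε => Eventually.of_forall fun z =>
        norm_indicator_le_norm_self _ _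
    · refine Eventually.of_forall fun z => tendsto_const_nhds.congr' ?_
      rcases eq_or_ne z 0 with rfl | hz
      · refine Eventually.of_forall fun ε => ?_
        have : halfPowSecondDiff N s x 0 = 0 := by
          simp [halfPowSecondDiff, two_mul]
        simp [indicator, this]
      · have hz' : 0 < ‖z‖ := norm_pos_iff.2 hz
        filter_upwards [Ioo_mem_nhdsGT hz', Ioo_mem_nhdsGT (inv_pos.2 hz')] with ε h1 h2
        refine (indicator_of_mem (show z ∈ annulus N ε from ⟨h1.2, ?_⟩) _).symm
        rw [one_div]
        exact (lt_inv_comm₀ h1.1 hz').1 h2.2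
  have hhalf := hlim.const_mul (1 / 2)
  rw [mul_zero] at hhalf
  refine hhalf.congr' ?_
  filter_upwards [self_mem_nhdsWithin] with ε (hε : 0 < ε)
  set F : EuclideanSpace ℝ (Fin N) → ℝ :=
    fun z => (halfPow N s x - halfPow N s (x + z)) / ‖z‖ ^ ((N : ℝ) + 2 * s) with hF
  have hFI : Integrable ((annulus N ε).indicator F) := by
    have h1 : MeasurableSet {y : EuclideanSpace ℝ (Fin N) | ε < ‖y - x‖ ∧ ‖y - x‖ < 1 / ε} :=
      (measurable_norm.comp (measurable_id.sub_const x)) measurableSet_Ioo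
    have h2 := (integrableOn_fracKernel_halfPow hs x hε).mono_set
      (show {y : EuclideanSpace ℝ (Fin N) | ε < ‖y - x‖ ∧ ‖y - x‖ < 1 / ε} ⊆ _ from
        fun y hy => hy.1)
    rw [← integrable_indicator_iff h1] at h2
    refine (h2.comp_add_left x).congr (Eventually.of_forall fun z => ?_)
    simp [indicator, annulus, fracKernel, hF]
  have hpv : pvInt N s (halfPow N s) x ε = ∫ z, (annulus N ε).indicator F z :=
    (integral_indicator (hm ε)).symm
  have hsum : ∫ z in annulus N ε, halfPowSecondDiff N s x z =
      (∫ z, (annulus N ε).indicator F z) + ∫ z, (annulus N ε).indicator F (-z) := by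
    rw [← integral_add hFI hFI.comp_neg, ← integral_indicator (hm ε)]
    congr 1
    ext z
    by_cases hz : z ∈ annulus N ε
    · have hz' : -z ∈ annulus N ε := by simpa [annulus] using hz
      rw [indicator_of_mem hz, indicator_of_mem hz, indicator_of_mem hz', halfPowSecondDiff, hF]
      simp only [norm_neg, ← sub_eq_add_neg]
      ring
    · have hz' : -z ∉ annulus N ε := by simpa [annulus] using hz
      rw [indicator_of_notMem hz, indicator_of_notMem hz, indicator_of_notMem hz', add_zero]
  rw [hsum, integral_neg_eq_self, hpv]
  ring


lemma DifferentiableAt.exists_norm_fracKernel_le {N : ℕ} (s : ℝ)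
    {g : EuclideanSpace ℝ (Fin N) → ℝ} {x : EuclideanSpace ℝ (Fin N)}
    (hg : DifferentiableAt ℝ g x) :
    ∃ L : ℝ, 0 ≤ L ∧ ∃ δ : ℝ, 0 < δ ∧ ∀ y, ‖y - x‖ < δ →
      ‖fracKernel N s g x y‖ ≤ L * ‖y - x‖ ^ (1 - ((N : ℝ) + 2 * s)) := by
  obtain ⟨L, hL, hO⟩ := hg.isBigO_sub.exists_nonneg
  obtain ⟨δ, hδ, hb⟩ := Metric.eventually_nhds_iff.1 hO.bound
  refine ⟨L, hL, δ, hδ, fun y hy => ?_⟩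
  rcases eq_or_ne y x with rfl | hne
  · rw [fracKernel, sub_self, zero_div, norm_zero]
    positivity
  have hpos : 0 < ‖y - x‖ := norm_pos_iff.2 (sub_ne_zero.2 hne)
  have h := hb (by rwa [dist_eq_norm])
  rw [fracKernel, norm_div, norm_sub_rev,
    Real.norm_of_nonneg (Real.rpow_nonneg (norm_nonneg (y - x)) ((N : ℝ) + 2 * s)),
    Real.rpow_sub hpos, Real.rpow_one, ← mul_div_assoc]
  gcongr

lemma differentiableAt_halfPow {N : ℕ} [NeZero N] (s : ℝ) {x : EuclideanSpace ℝ (Fin N)}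
    (hx : 0 < x 0) : DifferentiableAt ℝ (halfPow N s) x := by
  have hproj : DifferentiableAt ℝ (fun y : EuclideanSpace ℝ (Fin N) => y 0) x :=
    (EuclideanSpace.proj (𝕜 := ℝ) (0 : Fin N)).differentiableAt
  refine (hproj.rpow_const (p := s) (Or.inl hx.ne')).congr_of_eventuallyEq ?_
  filter_upwards [hproj.continuousAt.eventually (lt_mem_nhds hx)] with y hy
  rw [halfPow, max_eq_left hy.le]

lemma ne_zero_of_apply_zero_pos {N : ℕ} [NeZero N] {x : EuclideanSpace ℝ (Fin N)}
    (hx : 0 < x 0) : x ≠ 0 := by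
  rintro rfl
  simp at hx

lemma differentiableAt_halfKelvin {N : ℕ} [NeZero N] (s : ℝ) {x : EuclideanSpace ℝ (Fin N)}
    (hx : 0 < x 0) : DifferentiableAt ℝ (halfKelvin N s) x := by
  have hx0 := ne_zero_of_apply_zero_pos hx
  exact (differentiableAt_halfPow s hx).mul
    ((differentiableAt_id.norm ℝ hx0).rpow_const (Or.inl (norm_ne_zero_iff.2 hx0)))

lemma symmExterior_subset {N : ℕ} (x : EuclideanSpace ℝ (Fin N)) (ε : ℝ) :
    symmExterior x ε ⊆ {y | ε < ‖y - x‖} := fun _ hy => hy.2.1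

lemma integrableOn_halfKelvin_symmExterior {N : ℕ} [NeZero N] {s : ℝ} (hs : s ∈ Ioo (0 : ℝ) 1)
    {x : EuclideanSpace ℝ (Fin N)} (hx : x ≠ 0) {ε : ℝ} (hε : 0 < ε) :
    IntegrableOn (fun y => halfKelvin N s y / ‖y - x‖ ^ ((N : ℝ) + 2 * s)) (symmExterior x ε) :=
  (integrableOn_symmExterior_kelvin s hx hε).2
    (((integrableOn_halfPow_exterior hs x hε).mono_set (symmExterior_subset x ε)).const_mul _)

lemma fracKernel_eq_sub {N : ℕ} (s : ℝ) (g : EuclideanSpace ℝ (Fin N) → ℝ)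
    (x : EuclideanSpace ℝ (Fin N)) :
    fracKernel N s g x = fun y => g x * (1 / ‖y - x‖ ^ ((N : ℝ) + 2 * s)) -
      g y / ‖y - x‖ ^ ((N : ℝ) + 2 * s) := by
  ext y
  rw [fracKernel]
  ring

lemma integrableOn_fracKernel_halfKelvin {N : ℕ} [NeZero N] {s : ℝ} (hs : s ∈ Ioo (0 : ℝ) 1)
    {x : EuclideanSpace ℝ (Fin N)} (hx : x ≠ 0) {ε : ℝ} (hε : 0 < ε) :
    IntegrableOn (fracKernel N s (halfKelvin N s) x) (symmExterior x ε) := by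
  rw [fracKernel_eq_sub]
  exact (((integrableOn_kernel_exterior (Nat.pos_of_ne_zero (NeZero.ne N)) hs.1 x hε).mono_set
    (symmExterior_subset x ε)).const_mul _).sub (integrableOn_halfKelvin_symmExterior hs hx hε)

lemma setIntegral_fracKernel_halfKelvin {N : ℕ} [NeZero N] {s : ℝ} (hs : s ∈ Ioo (0 : ℝ) 1)
    {x : EuclideanSpace ℝ (Fin N)} (hx : x ≠ 0) {ε : ℝ} (hε : 0 < ε) :
    ∫ y in symmExterior x ε, fracKernel N s (halfKelvin N s) x y =
      ‖x‖ ^ (-(N : ℝ)) * ∫ y in symmExterior x ε, fracKernel N s (halfPow N s) x y := by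
  have hk := (integrableOn_kernel_exterior (Nat.pos_of_ne_zero (NeZero.ne N)) hs.1 x hε).mono_set
    (symmExterior_subset x ε)
  have hv := (integrableOn_halfPow_exterior hs x hε).mono_set (symmExterior_subset x ε)
  rw [fracKernel_eq_sub, fracKernel_eq_sub, integral_sub (hk.const_mul _) hv,
    integral_sub (hk.const_mul _) (integrableOn_halfKelvin_symmExterior hs hx hε),
    integral_const_mul, integral_const_mul, setIntegral_symmExterior_kelvin s hx hε, halfKelvin]
  ring

/-- The function `(y₁)₊ ^ s * ‖y‖ ^ (-N)` is `s`-harmonic in the half-space. -/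
lemma tendsto_pvInt_halfKelvin {N : ℕ} [NeZero N] {s : ℝ} (hs : s ∈ Ioo (0 : ℝ) 1)
    {x : EuclideanSpace ℝ (Fin N)} (hx : 0 < x 0) :
    Tendsto (pvInt N s (halfKelvin N s) x) (𝓝[>] (0 : ℝ)) (𝓝 0) := by
  have hN : 0 < N := Nat.pos_of_ne_zero (NeZero.ne N)
  have hx0 := ne_zero_of_apply_zero_pos hx
  obtain ⟨L, hL, δ, hδ, hb⟩ := (differentiableAt_halfPow s hx).exists_norm_fracKernel_le s
  obtain ⟨L', hL', δ', hδ', hb'⟩ := (differentiableAt_halfKelvin s hx).exists_norm_fracKernel_le s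
  have hv := tendsto_annulus_sub_symmExterior hN hs hL hδ
    (measurable_fracKernel s (measurable_halfPow s) x) hb
    (fun ε hε => (integrableOn_fracKernel_halfPow hs x hε).mono_set (symmExterior_subset x ε)) hx0
  have hu := tendsto_annulus_sub_symmExterior hN hs hL' hδ'
    (measurable_fracKernel s (measurable_halfKelvin s) x) hb'
    (fun ε hε => integrableOn_fracKernel_halfKelvin hs hx0 hε) hx0
  simp_rw [← pvInt_eq] at hv hu
  have h := hu.add (((tendsto_pvInt_halfPow hs hx).sub hv).const_mul (‖x‖ ^ (-(N : ℝ))))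
  rw [sub_zero, mul_zero, add_zero] at h
  refine h.congr' ?_
  filter_upwards [self_mem_nhdsWithin] with ε (hε : 0 < ε)
  rw [setIntegral_fracKernel_halfKelvin hs hx0 hε]
  ring

lemma Ps_eq_const_mul_halfKelvin {N : ℕ} [NeZero N] {s : ℝ} (hs : s ≠ 0)
    (y : EuclideanSpace ℝ (Fin N)) : Ps N s y = Ks N s * halfKelvin N s y := by
  rw [Ps, halfKelvin, halfPow]
  split_ifs with h
  · rw [max_eq_left h.le, mul_assoc]
  · rw [max_eq_right (not_lt.1 h), Real.zero_rpow hs, zero_mul, mul_zero]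

lemma pvInt_Ps {N : ℕ} [NeZero N] {s : ℝ} (hs : s ≠ 0) (x : EuclideanSpace ℝ (Fin N)) (ε : ℝ) :
    pvInt N s (Ps N s) x ε = Ks N s * pvInt N s (halfKelvin N s) x ε := by
  rw [pvInt, pvInt, ← integral_const_mul]
  congr 1
  ext z
  rw [Ps_eq_const_mul_halfKelvin hs, Ps_eq_const_mul_halfKelvin hs]
  ring

/-- The function `𝒫_s(x) = 𝒦_s x₁^s |x|^{-N}` (extended by `0` for `x₁ ≤ 0`) is `s`-harmonic
in the upper half-space: at every `x` with `x₁ > 0`, the principal value limit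
`lim_{ε→0⁺} c_{N,s} ∫_{ε<|z|<1/ε} (𝒫_s(x) - 𝒫_s(x+z)) |z|^{-N-2s} dz` exists and equals `0`. -/
theorem Ps_sHarmonic
    (N : ℕ) [NeZero N] (hN : 2 ≤ N) (s : ℝ) (hs : s ∈ Ioo (0 : ℝ) 1) :
    ∀ x : EuclideanSpace ℝ (Fin N), 0 < x 0 → SHarmonicAt N s (Ps N s) x := by
  intro x hx
  have h := ((tendsto_pvInt_halfKelvin hs hx).const_mul (Ks N s)).const_mul (cns N s)
  rw [mul_zero, mul_zero] at h
  exact h.congr fun ε => by rw [pvInt_Ps hs.1.ne']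
end
end

section
/- Let N ≥ 2 and s ∈ (0,1). For every compact set O contained in the closure of ℝ^N_+ with 0 ∉ O, there exist c > 0 and ε_0 ∈ (0,1/8) such that for all ε ∈ (0,ε_0) and all x ∈ O with x_1 > 0, |ε^{−s} 𝒢_{s,∞}(x, ε e_1) − 𝒫_s(x)| ≤ c ε^s x_1^s |x|^{−N}, where e_1 = (1,0,…,0). -/
open MeasureTheory Real Filter Set Topology

noncomputable section

/-- The Green kernel `𝒢_{s,∞}` of the fractional Laplacian in the half-space. -/
def Gs (N : ℕ) [NeZero N] (s : ℝ) (x y : EuclideanSpace ℝ (Fin N)) : ℝ :=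
  if 0 < x 0 ∧ 0 < y 0 then
    (kap N s / 2) * ‖x - y‖ ^ (2 * s - (N : ℝ)) *
      ∫ t in Ioo (0 : ℝ) (4 * x 0 * y 0 / ‖x - y‖ ^ 2),
        t ^ (s - 1) * (1 + t) ^ (-(N : ℝ) / 2)
  else 0

/-- First-order lower bound for a negative power of `1 + t`. -/
lemma one_sub_mul_le_one_add_rpow_neg {a t : ℝ} (ha : 0 ≤ a) (ht : 0 ≤ t) :
    1 - a * t ≤ (1 + t) ^ (-a) := by
  have h1 : Real.log (1 + t) ≤ t := by
    linarith [Real.log_le_sub_one_of_pos (show 0 < 1 + t by linarith)]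
  rw [Real.rpow_def_of_pos (by linarith)]
  nlinarith [Real.add_one_le_exp (Real.log (1 + t) * -a), mul_le_mul_of_nonneg_left h1 ha]

lemma integrableOn_Ioo_rpow_sub_one {s : ℝ} (hs : 0 < s) (T : ℝ) :
    IntegrableOn (fun t : ℝ => t ^ (s - 1)) (Ioo 0 T) := by
  rcases le_or_gt T 0 with hT | hT
  · simp [Ioo_eq_empty (not_lt.mpr hT)]
  · have h := intervalIntegral.intervalIntegrable_rpow' (a := 0) (b := T)
      (show -1 < s - 1 by linarith)
    rw [intervalIntegrable_iff_integrableOn_Ioo_of_le hT.le] at h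
    exact h

lemma setIntegral_Ioo_rpow_sub_one {s T : ℝ} (hs : 0 < s) (hT : 0 ≤ T) :
    ∫ t in Ioo (0 : ℝ) T, t ^ (s - 1) = T ^ s / s := by
  rw [← integral_Ioc_eq_integral_Ioo, ← intervalIntegral.integral_of_le hT,
    integral_rpow (Or.inl (by linarith))]
  simp [Real.zero_rpow hs.ne']

/-- The incomplete beta-type integral is `T ^ s / s` up to a relative error `a * T`. -/
lemma abs_setIntegral_rpow_mul_sub_le {s a T : ℝ} (hs : 0 < s) (ha : 0 ≤ a) (hT : 0 ≤ T) :
    |(∫ t in Ioo (0 : ℝ) T, t ^ (s - 1) * (1 + t) ^ (-a)) - T ^ s / s| ≤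
      a * T * (T ^ s / s) := by
  have hi := integrableOn_Ioo_rpow_sub_one hs T
  have hle : ∀ t ∈ Ioo (0 : ℝ) T, t ^ (s - 1) * (1 + t) ^ (-a) ≤ t ^ (s - 1) := fun t ht =>
    mul_le_of_le_one_right (Real.rpow_nonneg ht.1.le _)
      (Real.rpow_le_one_of_one_le_of_nonpos (by linarith [ht.1]) (by linarith))
  have hi' : IntegrableOn (fun t : ℝ => t ^ (s - 1) * (1 + t) ^ (-a)) (Ioo 0 T) := by
    refine Integrable.mono' hi (by fun_prop) ?_
    filter_upwards [ae_restrict_mem measurableSet_Ioo] with t ht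
    have h1 : 0 ≤ t := ht.1.le
    rw [Real.norm_of_nonneg (by positivity)]
    exact hle t ht
  have hupper := setIntegral_mono_on hi' hi measurableSet_Ioo hle
  have hlower : ∫ t in Ioo (0 : ℝ) T, t ^ (s - 1) * (1 - a * T) ≤
      ∫ t in Ioo (0 : ℝ) T, t ^ (s - 1) * (1 + t) ^ (-a) := by
    refine setIntegral_mono_on (hi.mul_const _) hi' measurableSet_Ioo fun t ht => ?_
    refine mul_le_mul_of_nonneg_left ?_ (Real.rpow_nonneg ht.1.le _)
    linarith [one_sub_mul_le_one_add_rpow_neg ha ht.1.le, mul_le_mul_of_nonneg_left ht.2.le ha]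
  rw [integral_mul_const, setIntegral_Ioo_rpow_sub_one hs hT] at hlower
  rw [setIntegral_Ioo_rpow_sub_one hs hT] at hupper
  have : 0 ≤ a * T * (T ^ s / s) := by positivity
  rw [abs_le]
  constructor <;> nlinarith

/-- Comparison of the `N`-th inverse powers of two nearby positive numbers. -/
lemma abs_rpow_neg_sub_rpow_neg_le (N : ℕ) {r d ε : ℝ} (hr : 0 < r) (hε : ε ≤ r / 2)
    (h : |r - d| ≤ ε) :
    d ^ (-(N : ℝ)) ≤ 2 ^ N * r ^ (-(N : ℝ)) ∧
      |d ^ (-(N : ℝ)) - r ^ (-(N : ℝ))| ≤ (2 * ε / r) * N * 2 ^ N * r ^ (-(N : ℝ)) := by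
  have hε0 : 0 ≤ ε := (abs_nonneg _).trans h
  have hd : r / 2 ≤ d := by linarith [(abs_le.mp h).2]
  have hd0 : 0 < d := by linarith
  have hu2 : r / d ≤ 2 := by rw [div_le_iff₀ hd0]; linarith
  have hu0 : 0 < r / d := by positivity
  have hu1 : |r / d - 1| ≤ 2 * ε / r := by
    rw [div_sub_one hd0.ne', abs_div, abs_of_pos hd0, div_le_div_iff₀ hd0 hr]
    nlinarith
  have hfac : d ^ (-(N : ℝ)) = (r / d) ^ N * r ^ (-(N : ℝ)) := by
    rw [Real.rpow_neg hd0.le, Real.rpow_neg hr.le, Real.rpow_natCast, Real.rpow_natCast,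
      div_pow]
    field_simp
  have hrN : 0 ≤ r ^ (-(N : ℝ)) := Real.rpow_nonneg hr.le _
  constructor
  · rw [hfac]
    gcongr
  · have hmax : max |r / d| |(1 : ℝ)| ≤ 2 := by
      rw [abs_of_pos hu0]; simpa using hu2
    have hpow : max |r / d| |(1 : ℝ)| ^ (N - 1) ≤ 2 ^ N :=
      (pow_le_pow_left₀ (le_max_of_le_left (abs_nonneg _)) hmax _).trans
        (pow_le_pow_right₀ one_le_two (Nat.sub_le N 1))
    have hsub : |(r / d) ^ N - 1| ≤ (2 * ε / r) * N * 2 ^ N := by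
      have := abs_pow_sub_pow_le (r / d) 1 N
      rw [one_pow] at this
      refine this.trans ?_
      gcongr
    rw [hfac, ← sub_one_mul, abs_mul, abs_of_nonneg hrN]
    gcongr

lemma norm_e1 (N : ℕ) [NeZero N] : ‖e1 N‖ = 1 := by simp [e1]

/-- The leading part of the rescaled Green kernel is the Poisson-type kernel at distance `d`. -/
lemma rescaled_green_leading {s k p x ε d : ℝ} (hx : 0 < x) (hε : 0 < ε) (hd : 0 < d) :
    ε ^ (-s) * (k / 2 * d ^ (2 * s - p) * ((4 * x * ε / d ^ 2) ^ s / s)) =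
      k * 2 ^ (2 * s - 1) / s * x ^ s * d ^ (-p) := by
  have h4 : (4 : ℝ) ^ s = 2 ^ (2 * s - 1) * 2 := by
    rw [show (4 : ℝ) = 2 ^ (2 : ℝ) by norm_num, ← Real.rpow_mul zero_le_two,
      ← Real.rpow_add_one two_ne_zero]
    ring_nf
  have hd2 : (d ^ 2) ^ s = d ^ (2 * s) := by
    rw [← Real.rpow_natCast, ← Real.rpow_mul hd.le]; norm_num
  rw [Real.div_rpow (by positivity) (by positivity), Real.mul_rpow (by positivity) hε.le,
    Real.mul_rpow (by positivity) hx.le, h4, hd2, Real.rpow_sub hd, Real.rpow_neg hε.le,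
    Real.rpow_neg hd.le]
  have h1 : ε ^ s ≠ 0 := (Real.rpow_pos_of_pos hε _).ne'
  have h2 : d ^ (2 * s) ≠ 0 := (Real.rpow_pos_of_pos hd _).ne'
  have h3 : d ^ p ≠ 0 := (Real.rpow_pos_of_pos hd _).ne'
  field_simp

/-- The estimate at one point, with an explicit constant and a linear rate in `ε / ‖x‖`. -/
lemma abs_rescaled_green_sub_le (N : ℕ) [NeZero N] {s ε : ℝ} (hs : 0 < s) (hε : 0 < ε)
    {x : EuclideanSpace ℝ (Fin N)} (hx : 0 < x 0) (hεx : ε ≤ ‖x‖ / 2) :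
    |ε ^ (-s) * Gs N s x (ε • e1 N) - Ps N s x| ≤
      |Ks N s| * (10 * N * 2 ^ N) * (ε / ‖x‖) * (x 0) ^ s * ‖x‖ ^ (-(N : ℝ)) := by
  have hr : 0 < ‖x‖ := by linarith
  have hy : (ε • e1 N) 0 = ε := by simp [e1]
  have hdist : |‖x‖ - ‖x - ε • e1 N‖| ≤ ε := by
    have h := abs_norm_sub_norm_le x (x - ε • e1 N)
    rwa [sub_sub_cancel, norm_smul, norm_e1, mul_one, Real.norm_of_nonneg hε.le] at h
  have hxr : x 0 ≤ ‖x‖ := (le_abs_self _).trans (PiLp.norm_apply_le x 0)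
  simp only [Gs, Ps, hy, hx, hε, and_self, if_true]
  set r := ‖x‖
  set d := ‖x - ε • e1 N‖
  have hd2 : r / 2 ≤ d := by linarith [(abs_le.mp hdist).2]
  have hd : 0 < d := by linarith
  obtain ⟨hdN, hdiff⟩ := abs_rpow_neg_sub_rpow_neg_le N hr hεx hdist
  have hTle : 4 * x 0 * ε / d ^ 2 ≤ 16 * (ε / r) := by
    rw [← mul_div_assoc, div_le_div_iff₀ (by positivity) hr]
    have h1 : x 0 * r ≤ r * r := by gcongr
    have h2 : r * r ≤ 4 * d ^ 2 := by nlinarith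
    nlinarith
  have hlead := rescaled_green_leading (s := s) (k := kap N s) (p := N) hx hε hd
  have hT : 0 ≤ 4 * x 0 * ε / d ^ 2 := by positivity
  have hI := abs_setIntegral_rpow_mul_sub_le hs (a := (N : ℝ) / 2) (by positivity) hT
  rw [← neg_div] at hI
  set T := 4 * x 0 * ε / d ^ 2
  set I := ∫ t in Ioo (0 : ℝ) T, t ^ (s - 1) * (1 + t) ^ (-(N : ℝ) / 2)
  have hxs : 0 ≤ x 0 ^ s := Real.rpow_nonneg hx.le _
  have hdN0 : 0 ≤ d ^ (-(N : ℝ)) := Real.rpow_nonneg hd.le _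
  have hrN0 : 0 ≤ r ^ (-(N : ℝ)) := Real.rpow_nonneg hr.le _
  have hP : kap N s * 2 ^ (2 * s - 1) / s = Ks N s := rfl
  rw [hP] at hlead
  set A := ε ^ (-s) * (kap N s / 2 * d ^ (2 * s - (N : ℝ)))
  have hlead' : A * (T ^ s / s) = Ks N s * x 0 ^ s * d ^ (-(N : ℝ)) := by
    rw [← hlead]; simp only [A]; ring
  have hL : 0 ≤ T ^ s / s := by positivity
  have herr : |A * (I - T ^ s / s)| ≤
      |Ks N s| * x 0 ^ s * (2 ^ N * r ^ (-(N : ℝ))) * (N / 2 * (16 * (ε / r))) := by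
    calc |A * (I - T ^ s / s)| ≤ |A| * ((N : ℝ) / 2 * T * (T ^ s / s)) := by
          rw [abs_mul]; gcongr
      _ = |A * (T ^ s / s)| * ((N : ℝ) / 2 * T) := by
          rw [abs_mul A, abs_of_nonneg hL]; ring
      _ = |Ks N s| * x 0 ^ s * d ^ (-(N : ℝ)) * ((N : ℝ) / 2 * T) := by
          rw [hlead', abs_mul, abs_mul, abs_of_nonneg hxs, abs_of_nonneg hdN0]
      _ ≤ _ := by gcongr
  calc |ε ^ (-s) * (kap N s / 2 * d ^ (2 * s - (N : ℝ)) * I)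
          - Ks N s * x 0 ^ s * r ^ (-(N : ℝ))|
      = |A * (I - T ^ s / s) + Ks N s * x 0 ^ s * (d ^ (-(N : ℝ)) - r ^ (-(N : ℝ)))| := by
        rw [mul_sub, mul_sub, hlead']; congr 1; simp only [A]; ring
    _ ≤ |A * (I - T ^ s / s)| +
          |Ks N s| * x 0 ^ s * |d ^ (-(N : ℝ)) - r ^ (-(N : ℝ))| := by
        refine (abs_add_le _ _).trans_eq ?_
        rw [abs_mul (Ks N s * x 0 ^ s), abs_mul (Ks N s), abs_of_nonneg hxs]
    _ ≤ |Ks N s| * x 0 ^ s * (2 ^ N * r ^ (-(N : ℝ))) * (N / 2 * (16 * (ε / r))) +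
          |Ks N s| * x 0 ^ s * ((2 * ε / r) * N * 2 ^ N * r ^ (-(N : ℝ))) := by gcongr
    _ = _ := by ring

/-- Quantitative approximation of `𝒫_s` by the rescaled Green kernel: for every compact set
`O` in the closed half-space with `0 ∉ O`, there are `c > 0` and `ε₀ ∈ (0,1/8)` such that for
all `ε ∈ (0,ε₀)` and `x ∈ O` with `x₁ > 0`,
`|ε^{-s} 𝒢_{s,∞}(x, ε e₁) - 𝒫_s(x)| ≤ c ε^s x₁^s |x|^{-N}`. -/
theorem green_approx_pointwise
    (N : ℕ) [NeZero N] (hN : 2 ≤ N) (s : ℝ) (hs : s ∈ Ioo (0 : ℝ) 1) :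
    ∀ O : Set (EuclideanSpace ℝ (Fin N)), IsCompact O →
      O ⊆ {x | 0 ≤ x 0} → (0 : EuclideanSpace ℝ (Fin N)) ∉ O →
      ∃ c : ℝ, 0 < c ∧ ∃ ε₀ ∈ Ioo (0 : ℝ) (1 / 8), ∀ ε ∈ Ioo (0 : ℝ) ε₀, ∀ x ∈ O, 0 < x 0 →
        |ε ^ (-s) * Gs N s x (ε • e1 N) - Ps N s x| ≤ c * ε ^ s * (x 0) ^ s * ‖x‖ ^ (-(N : ℝ)) := by
  intro O hO _ h0
  obtain ⟨δ, hδ, hball⟩ := Metric.mem_nhds_iff.mp (hO.isClosed.isOpen_compl.mem_nhds h0)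
  have hnorm : ∀ x ∈ O, δ ≤ ‖x‖ := fun x hx => by
    by_contra! hlt
    exact hball (by simpa using hlt) hx
  refine ⟨|Ks N s| * (10 * N * 2 ^ N) / δ + 1, by positivity, min (δ / 2) (1 / 16),
    ⟨by positivity, (min_le_right _ _).trans_lt (by norm_num)⟩, fun ε hε x hxO hx => ?_⟩
  have hε0 : 0 < ε := hε.1
  have hεδ : ε < δ / 2 := hε.2.trans_le (min_le_left _ _)
  have hε1 : ε ≤ 1 := (hε.2.trans_le (min_le_right _ _)).le.trans (by norm_num)
  have hδx := hnorm x hxO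
  have hεs : ε ≤ ε ^ s := by
    simpa using Real.rpow_le_rpow_of_exponent_ge hε0 hε1 hs.2.le
  refine (abs_rescaled_green_sub_le N hs.1 hε0 hx (by linarith)).trans ?_
  have hrate : ε / ‖x‖ ≤ ε ^ s / δ := by gcongr
  refine mul_le_mul_of_nonneg_right (mul_le_mul_of_nonneg_right ?_
    (Real.rpow_nonneg hx.le _)) (Real.rpow_nonneg (norm_nonneg _) _)
  calc |Ks N s| * (10 * N * 2 ^ N) * (ε / ‖x‖)
      ≤ |Ks N s| * (10 * N * 2 ^ N) * (ε ^ s / δ) := by gcongr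
    _ = |Ks N s| * (10 * N * 2 ^ N) / δ * ε ^ s := by ring
    _ ≤ (|Ks N s| * (10 * N * 2 ^ N) / δ + 1) * ε ^ s := by gcongr; linarith
end
end

section
/- Let N ≥ 2 and s ∈ (0,1). Then ε^{−s} 𝒢_{s,∞}(·, ε e_1) → 𝒫_s as ε → 0^+ in L^1_s(ℝ^N_+) and uniformly on every compact subset of ℝ^N_+; that is, lim_{ε→0^+} ∫_{ℝ^N_+} |ε^{−s} 𝒢_{s,∞}(x, ε e_1) − 𝒫_s(x)| (1+|x|^{N+2s})^{−1} dx = 0, and for every compact set O ⊂ ℝ^N_+, sup_{x ∈ O} |ε^{−s} 𝒢_{s,∞}(x, ε e_1) − 𝒫_s(x)| → 0 as ε → 0^+. -/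
open MeasureTheory Real Filter Set Topology

noncomputable section

/-- The primitive `∫₀^z t^{s-1} (1+t)^{-N/2} dt` entering the Green kernel. -/
def greenPrimitive (N : ℕ) (s z : ℝ) : ℝ :=
  ∫ t in Ioo (0 : ℝ) z, t ^ (s - 1) * (1 + t) ^ (-(N : ℝ) / 2)

lemma kap_pos {N : ℕ} [NeZero N] {s : ℝ} (hs : s ∈ Ioo (0 : ℝ) 1) : 0 < kap N s := by
  have hN : (0 : ℝ) < N := by exact_mod_cast Nat.pos_of_ne_zero (NeZero.ne N)
  have h1 : 0 < Real.sin (Real.pi * s) :=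
    Real.sin_pos_of_pos_of_lt_pi (mul_pos Real.pi_pos hs.1) (by nlinarith [Real.pi_pos, hs.2])
  have h2 : 0 < Real.Gamma ((N : ℝ) / 2) := Real.Gamma_pos_of_pos (by positivity)
  unfold kap
  positivity

lemma Ks_pos {N : ℕ} [NeZero N] {s : ℝ} (hs : s ∈ Ioo (0 : ℝ) 1) : 0 < Ks N s := by
  have := kap_pos (N := N) hs
  have := hs.1
  unfold Ks
  positivity

lemma two_rpow_two_mul_sub_one (s : ℝ) : (2 : ℝ) ^ (2 * s - 1) = 4 ^ s / 2 := by
  rw [Real.rpow_sub_one two_ne_zero, Real.rpow_mul zero_le_two]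
  norm_num

lemma integrableOn_Ioo_rpow {p : ℝ} (hp : -1 < p) (z : ℝ) :
    IntegrableOn (fun t : ℝ => t ^ p) (Ioo 0 z) :=
  (intervalIntegral.intervalIntegrable_rpow' hp (a := 0) (b := z)).1.mono_set Ioo_subset_Ioc_self

lemma integral_Ioo_rpow {p z : ℝ} (hp : -1 < p) (hz : 0 ≤ z) :
    ∫ t in Ioo 0 z, t ^ p = z ^ (p + 1) / (p + 1) := by
  rw [← integral_Ioc_eq_integral_Ioo, ← intervalIntegral.integral_of_le hz,
    integral_rpow (Or.inl hp), Real.zero_rpow (by linarith), sub_zero]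

lemma integrableOn_Ioi_of_le_rpow {f : ℝ → ℝ} {p q : ℝ} (hp : -1 < p) (hq : q < -1)
    (hf : Measurable f) (h0 : ∀ t, 0 < t → 0 ≤ f t) (hfp : ∀ t, 0 < t → f t ≤ t ^ p)
    (hfq : ∀ t, 0 < t → f t ≤ t ^ q) : IntegrableOn f (Ioi 0) := by
  rw [← Ioc_union_Ioi_eq_Ioi (zero_le_one' ℝ)]
  refine IntegrableOn.union ?_ ?_
  · refine (intervalIntegral.intervalIntegrable_rpow' hp (a := 0) (b := 1)).1.mono'
      hf.aestronglyMeasurable ((ae_restrict_iff' measurableSet_Ioc).2 (.of_forall fun t ht => ?_))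
    rw [Real.norm_of_nonneg (h0 t ht.1)]
    exact hfp t ht.1
  · refine (integrableOn_Ioi_rpow_of_lt hq zero_lt_one).mono'
      hf.aestronglyMeasurable ((ae_restrict_iff' measurableSet_Ioi).2 (.of_forall fun t ht => ?_))
    have ht' : 0 < t := zero_lt_one.trans ht
    rw [Real.norm_of_nonneg (h0 t ht')]
    exact hfq t ht'

lemma integrableOn_greenPrimitive {N : ℕ} (hN : 2 ≤ N) {s : ℝ} (hs : s ∈ Ioo (0 : ℝ) 1) :
    IntegrableOn (fun t : ℝ => t ^ (s - 1) * (1 + t) ^ (-(N : ℝ) / 2)) (Ioi 0) := by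
  have hN' : (2 : ℝ) ≤ N := by exact_mod_cast hN
  refine integrableOn_Ioi_of_le_rpow (p := s - 1) (q := s - 2) (by linarith [hs.1])
    (by linarith [hs.2]) (by fun_prop) (fun t ht => by positivity) (fun t ht => ?_) fun t ht => ?_
  · exact mul_le_of_le_one_right (by positivity)
      (Real.rpow_le_one_of_one_le_of_nonpos (by linarith) (by linarith))
  · calc t ^ (s - 1) * (1 + t) ^ (-(N : ℝ) / 2) ≤ t ^ (s - 1) * t ^ (-1 : ℝ) := by
          gcongr
          calc (1 + t) ^ (-(N : ℝ) / 2) ≤ (1 + t) ^ (-1 : ℝ) :=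
                Real.rpow_le_rpow_of_exponent_le (by linarith) (by linarith)
            _ ≤ t ^ (-1 : ℝ) := Real.rpow_le_rpow_of_nonpos ht (by linarith) (by norm_num)
      _ = t ^ (s - 2) := by rw [← Real.rpow_add ht]; ring_nf

lemma greenPrimitive_nonneg (N : ℕ) (s z : ℝ) : 0 ≤ greenPrimitive N s z :=
  setIntegral_nonneg measurableSet_Ioo fun t ht => by
    have := ht.1
    positivity

lemma greenPrimitive_mono {N : ℕ} (hN : 2 ≤ N) {s : ℝ} (hs : s ∈ Ioo (0 : ℝ) 1) :
    Monotone (greenPrimitive N s) := fun a b hab =>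
  setIntegral_mono_set ((integrableOn_greenPrimitive hN hs).mono_set Ioo_subset_Ioi_self)
    ((ae_restrict_iff' measurableSet_Ioo).2 (.of_forall fun t ht => by
      have := ht.1
      simp only [Pi.zero_apply]
      positivity))
    (Ioo_subset_Ioo_right hab).eventuallyLE

lemma greenPrimitive_le {N : ℕ} (hN : 2 ≤ N) {s : ℝ} (hs : s ∈ Ioo (0 : ℝ) 1) (z : ℝ) :
    greenPrimitive N s z ≤ ∫ t in Ioi (0 : ℝ), t ^ (s - 1) * (1 + t) ^ (-(N : ℝ) / 2) :=
  setIntegral_mono_set (integrableOn_greenPrimitive hN hs)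
    ((ae_restrict_iff' measurableSet_Ioi).2 (.of_forall fun t (ht : 0 < t) => by
      simp only [Pi.zero_apply]
      positivity))
    Ioo_subset_Ioi_self.eventuallyLE

lemma greenPrimitive_le_rpow {N : ℕ} (hN : 2 ≤ N) {s : ℝ} (hs : s ∈ Ioo (0 : ℝ) 1) {z : ℝ}
    (hz : 0 ≤ z) : greenPrimitive N s z ≤ z ^ s / s := by
  have hi := integrableOn_Ioo_rpow (p := s - 1) (by linarith [hs.1]) z
  calc greenPrimitive N s z ≤ ∫ t in Ioo 0 z, t ^ (s - 1) := by
        refine setIntegral_mono_on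
          ((integrableOn_greenPrimitive hN hs).mono_set Ioo_subset_Ioi_self) hi
          measurableSet_Ioo fun t ht => ?_
        have := ht.1
        exact mul_le_of_le_one_right (by positivity)
          (Real.rpow_le_one_of_one_le_of_nonpos (by linarith)
            (div_nonpos_of_nonpos_of_nonneg (by simp) zero_le_two))
    _ = z ^ s / s := by
        rw [integral_Ioo_rpow (by linarith [hs.1]) hz, sub_add_cancel]

lemma rpow_le_greenPrimitive {N : ℕ} (hN : 2 ≤ N) {s : ℝ} (hs : s ∈ Ioo (0 : ℝ) 1) {z : ℝ}
    (hz : 0 ≤ z) : (1 + z) ^ (-(N : ℝ) / 2) * (z ^ s / s) ≤ greenPrimitive N s z := by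
  have hi := integrableOn_Ioo_rpow (p := s - 1) (by linarith [hs.1]) z
  calc (1 + z) ^ (-(N : ℝ) / 2) * (z ^ s / s)
      = ∫ t in Ioo 0 z, (1 + z) ^ (-(N : ℝ) / 2) * t ^ (s - 1) := by
        rw [integral_const_mul, integral_Ioo_rpow (by linarith [hs.1]) hz, sub_add_cancel]
    _ ≤ greenPrimitive N s z := by
        refine setIntegral_mono_on (hi.const_mul _)
          ((integrableOn_greenPrimitive hN hs).mono_set Ioo_subset_Ioi_self)
          measurableSet_Ioo fun t ht => ?_
        have := ht.1
        rw [mul_comm]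
        gcongr ?_ * ?_
        exact Real.rpow_le_rpow_of_nonpos (by linarith) (by linarith [ht.2])
          (div_nonpos_of_nonpos_of_nonneg (by simp) zero_le_two)

lemma rescaled_constant {N : ℕ} {s ε r a : ℝ} (hε : 0 < ε) (hr : 0 < r) (ha : 0 < a) :
    ε ^ (-s) * ((kap N s / 2) * r ^ (2 * s - (N : ℝ)) * ((4 * a * ε / r ^ 2) ^ s / s)) =
      Ks N s * a ^ s * r ^ (-(N : ℝ)) := by
  rw [Real.div_rpow (by positivity) (by positivity), Real.mul_rpow (by positivity) hε.le,
    Real.mul_rpow (by positivity) ha.le, ← Real.rpow_natCast r 2, ← Real.rpow_mul hr.le,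
    Ks, two_rpow_two_mul_sub_one, show 2 * s - (N : ℝ) = -N + (2 : ℕ) * s by push_cast; ring,
    Real.rpow_add hr, Real.rpow_neg hε.le]
  have h1 : r ^ ((2 : ℕ) * s) ≠ 0 := by positivity
  have h2 : ε ^ s ≠ 0 := by positivity
  field_simp

variable {N : ℕ} [NeZero N]

lemma norm_smul_e1 {ε : ℝ} (hε : 0 < ε) : ‖ε • e1 N‖ = ε := by
  simp [e1, norm_smul, abs_of_pos hε]

lemma norm_pos_of_apply_zero_pos {x : EuclideanSpace ℝ (Fin N)} (hx : 0 < x 0) : 0 < ‖x‖ :=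
  norm_pos_iff.2 fun h => by simp [h] at hx

lemma apply_zero_le_norm (x : EuclideanSpace ℝ (Fin N)) : x 0 ≤ ‖x‖ :=
  (le_abs_self _).trans (PiLp.norm_apply_le x 0)

lemma Ps_eq (s : ℝ) {x : EuclideanSpace ℝ (Fin N)} (hx : 0 < x 0) :
    Ps N s x = Ks N s * (x 0) ^ s * ‖x‖ ^ (-(N : ℝ)) := if_pos hx

lemma Gs_smul_e1 (s : ℝ) {ε : ℝ} (hε : 0 < ε) {x : EuclideanSpace ℝ (Fin N)} (hx : 0 < x 0) :
    Gs N s x (ε • e1 N) = (kap N s / 2) * ‖x - ε • e1 N‖ ^ (2 * s - (N : ℝ)) *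
      greenPrimitive N s (4 * x 0 * ε / ‖x - ε • e1 N‖ ^ 2) := by
  have h : (ε • e1 N) 0 = ε := by simp [e1]
  rw [Gs, h, if_pos ⟨hx, hε⟩, greenPrimitive]

lemma Gs_smul_e1_nonneg {s : ℝ} (hs : s ∈ Ioo (0 : ℝ) 1) {ε : ℝ} (hε : 0 < ε)
    {x : EuclideanSpace ℝ (Fin N)} (hx : 0 < x 0) : 0 ≤ Gs N s x (ε • e1 N) := by
  rw [Gs_smul_e1 s hε hx]
  have := kap_pos (N := N) hs
  have := greenPrimitive_nonneg N s (4 * x 0 * ε / ‖x - ε • e1 N‖ ^ 2)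
  positivity

lemma rescaled_green_le (hN : 2 ≤ N) {s : ℝ} (hs : s ∈ Ioo (0 : ℝ) 1) {ε : ℝ} (hε : 0 < ε)
    {x : EuclideanSpace ℝ (Fin N)} (hx : 0 < x 0) (hxε : x ≠ ε • e1 N) :
    ε ^ (-s) * Gs N s x (ε • e1 N) ≤ Ks N s * (x 0) ^ s * ‖x - ε • e1 N‖ ^ (-(N : ℝ)) := by
  have hr : 0 < ‖x - ε • e1 N‖ := norm_pos_iff.2 (sub_ne_zero.2 hxε)
  have := kap_pos (N := N) hs
  rw [Gs_smul_e1 s hε hx, ← rescaled_constant hε hr hx]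
  gcongr
  exact greenPrimitive_le_rpow hN hs (by positivity)

lemma le_rescaled_green (hN : 2 ≤ N) {s : ℝ} (hs : s ∈ Ioo (0 : ℝ) 1) {ε : ℝ} (hε : 0 < ε)
    {x : EuclideanSpace ℝ (Fin N)} (hx : 0 < x 0) (hxε : x ≠ ε • e1 N) :
    (1 + 4 * x 0 * ε / ‖x - ε • e1 N‖ ^ 2) ^ (-(N : ℝ) / 2) *
      (Ks N s * (x 0) ^ s * ‖x - ε • e1 N‖ ^ (-(N : ℝ))) ≤ ε ^ (-s) * Gs N s x (ε • e1 N) := by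
  have hr : 0 < ‖x - ε • e1 N‖ := norm_pos_iff.2 (sub_ne_zero.2 hxε)
  have := kap_pos (N := N) hs
  rw [Gs_smul_e1 s hε hx, ← rescaled_constant hε hr hx, mul_left_comm _ (ε ^ (-s)),
    mul_left_comm _ (kap N s / 2 * _)]
  gcongr
  exact rpow_le_greenPrimitive hN hs (by positivity)

lemma continuousAt_Ps (s : ℝ) {x₀ : EuclideanSpace ℝ (Fin N)} (hx₀ : 0 < x₀ 0) :
    ContinuousAt (Ps N s) x₀ := by
  have hev : ∀ᶠ x : EuclideanSpace ℝ (Fin N) in 𝓝 x₀, 0 < x 0 :=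
    (by fun_prop : Continuous fun x : EuclideanSpace ℝ (Fin N) => x 0).continuousAt.eventually
      (lt_mem_nhds hx₀)
  have h : ContinuousAt (fun x : EuclideanSpace ℝ (Fin N) =>
      Ks N s * (x 0) ^ s * ‖x‖ ^ (-(N : ℝ))) x₀ := by
    have h1 : ContinuousAt (fun x : EuclideanSpace ℝ (Fin N) => x 0) x₀ := by fun_prop
    exact (continuousAt_const.mul (h1.rpow_const (Or.inl hx₀.ne'))).mul
      (continuousAt_id.norm.rpow_const (Or.inl (norm_pos_of_apply_zero_pos hx₀).ne'))
  exact h.congr (hev.mono fun x hx => (Ps_eq s hx).symm)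

lemma tendsto_rescaled_green (hN : 2 ≤ N) {s : ℝ} (hs : s ∈ Ioo (0 : ℝ) 1)
    {x₀ : EuclideanSpace ℝ (Fin N)} (hx₀ : 0 < x₀ 0) :
    Tendsto (fun p : ℝ × EuclideanSpace ℝ (Fin N) => p.1 ^ (-s) * Gs N s p.2 (p.1 • e1 N))
      (𝓝[>] (0 : ℝ) ×ˢ 𝓝 x₀) (𝓝 (Ps N s x₀)) := by
  have hle : 𝓝[>] (0 : ℝ) ×ˢ 𝓝 x₀ ≤ 𝓝 ((0 : ℝ), x₀) := by
    rw [nhds_prod_eq]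
    exact prod_mono_left _ nhdsWithin_le_nhds
  have hn := norm_pos_of_apply_zero_pos hx₀
  have hU : ContinuousAt (fun p : ℝ × EuclideanSpace ℝ (Fin N) =>
      Ks N s * (p.2 0) ^ s * ‖p.2 - p.1 • e1 N‖ ^ (-(N : ℝ))) (0, x₀) := by
    have h1 : ContinuousAt (fun p : ℝ × EuclideanSpace ℝ (Fin N) => p.2 0) (0, x₀) := by fun_prop
    have h2 : ContinuousAt (fun p : ℝ × EuclideanSpace ℝ (Fin N) => ‖p.2 - p.1 • e1 N‖)
        (0, x₀) := by fun_prop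
    exact (continuousAt_const.mul (h1.rpow_const (Or.inl hx₀.ne'))).mul
      (h2.rpow_const (Or.inl (by simpa using hn.ne')))
  have hL : ContinuousAt (fun p : ℝ × EuclideanSpace ℝ (Fin N) =>
      (1 + 4 * p.2 0 * p.1 / ‖p.2 - p.1 • e1 N‖ ^ 2) ^ (-(N : ℝ) / 2)) (0, x₀) := by
    refine ContinuousAt.rpow_const (continuousAt_const.add
      (ContinuousAt.div (by fun_prop) (by fun_prop) ?_)) (Or.inl (by simp))
    simpa using hn.ne'
  have hU' := hU.tendsto.mono_left hle
  have hL' := (hL.mul hU).tendsto.mono_left hle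
  simp only [Pi.mul_def, zero_smul, sub_zero, mul_zero, zero_div, add_zero, Real.one_rpow, one_mul,
    ← Ps_eq s hx₀] at hU' hL'
  have hev : ∀ᶠ p : ℝ × EuclideanSpace ℝ (Fin N) in 𝓝[>] (0 : ℝ) ×ˢ 𝓝 x₀,
      0 < p.1 ∧ 0 < p.2 0 ∧ p.2 ≠ p.1 • e1 N := by
    have h1 : ∀ᶠ p : ℝ × EuclideanSpace ℝ (Fin N) in 𝓝[>] (0 : ℝ) ×ˢ 𝓝 x₀, 0 < p.1 :=
      tendsto_fst.eventually self_mem_nhdsWithin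
    have h2 : ∀ᶠ p : ℝ × EuclideanSpace ℝ (Fin N) in 𝓝 (0, x₀), 0 < p.2 0 :=
      (by fun_prop : Continuous fun p : ℝ × EuclideanSpace ℝ (Fin N) =>
        p.2 0).continuousAt.eventually (lt_mem_nhds hx₀)
    have h3 : ∀ᶠ p : ℝ × EuclideanSpace ℝ (Fin N) in 𝓝 (0, x₀), p.2 - p.1 • e1 N ≠ 0 := by
      refine (by fun_prop : Continuous fun p : ℝ × EuclideanSpace ℝ (Fin N) =>
        p.2 - p.1 • e1 N).continuousAt.eventually_ne ?_
      simpa using norm_pos_iff.1 hn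
    filter_upwards [h1, hle h2, hle h3] with p h1 h2 h3
    exact ⟨h1, h2, sub_ne_zero.1 h3⟩
  refine tendsto_of_tendsto_of_tendsto_of_le_of_le' hL' hU' ?_ ?_
  · filter_upwards [hev] with p hp using le_rescaled_green hN hs hp.1 hp.2.1 hp.2.2
  · filter_upwards [hev] with p hp using rescaled_green_le hN hs hp.1 hp.2.1 hp.2.2

lemma tendstoUniformlyOn_rescaled_green (hN : 2 ≤ N) {s : ℝ} (hs : s ∈ Ioo (0 : ℝ) 1)
    {O : Set (EuclideanSpace ℝ (Fin N))} (hO : IsCompact O) (hO' : O ⊆ {x | 0 < x 0}) :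
    TendstoUniformlyOn (fun (ε : ℝ) (x : EuclideanSpace ℝ (Fin N)) =>
      ε ^ (-s) * Gs N s x (ε • e1 N)) (Ps N s) (𝓝[>] (0 : ℝ)) O := by
  rw [← tendstoLocallyUniformlyOn_iff_tendstoUniformlyOn_of_compact hO,
    tendstoLocallyUniformlyOn_iff_forall_tendsto]
  intro x hx
  have hle : 𝓝[>] (0 : ℝ) ×ˢ 𝓝[O] x ≤ 𝓝[>] (0 : ℝ) ×ˢ 𝓝 x :=
    prod_mono_right _ nhdsWithin_le_nhds
  have h1 := (tendsto_rescaled_green hN hs (hO' hx)).mono_left hle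
  have h2 : Tendsto (fun p : ℝ × EuclideanSpace ℝ (Fin N) => Ps N s p.2)
      (𝓝[>] (0 : ℝ) ×ˢ 𝓝[O] x) (𝓝 (Ps N s x)) :=
    (continuousAt_Ps s (hO' hx)).tendsto.comp (tendsto_snd.mono_right nhdsWithin_le_nhds)
  rw [tendsto_uniformity_iff_dist_tendsto_zero]
  simpa using h2.dist h1

lemma tendsto_rescaled_green_apply (hN : 2 ≤ N) {s : ℝ} (hs : s ∈ Ioo (0 : ℝ) 1)
    {x : EuclideanSpace ℝ (Fin N)} (hx : 0 < x 0) :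
    Tendsto (fun ε : ℝ => ε ^ (-s) * Gs N s x (ε • e1 N)) (𝓝[>] (0 : ℝ)) (𝓝 (Ps N s x)) :=
  (tendsto_rescaled_green hN hs hx).comp (tendsto_id.prodMk tendsto_const_nhds)

lemma measurable_Ps (s : ℝ) : Measurable (Ps N s) :=
  Measurable.ite (measurableSet_lt measurable_const (by fun_prop)) (by fun_prop) measurable_const

lemma measurable_Gs_smul_e1 (hN : 2 ≤ N) {s : ℝ} (hs : s ∈ Ioo (0 : ℝ) 1) (ε : ℝ) :
    Measurable fun x => Gs N s x (ε • e1 N) := by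
  have := (greenPrimitive_mono hN hs).measurable
  have hH : MeasurableSet {x : EuclideanSpace ℝ (Fin N) | 0 < x 0} :=
    measurableSet_lt measurable_const (by fun_prop)
  refine Measurable.ite (hH.inter (MeasurableSet.const _)) (Measurable.mul ?_ ?_) measurable_const
  · fun_prop
  · have h0 : Measurable fun x : EuclideanSpace ℝ (Fin N) =>
        4 * x 0 * (ε • e1 N) 0 / ‖x - ε • e1 N‖ ^ 2 := by fun_prop
    exact this.comp h0

lemma Ps_nonneg {s : ℝ} (hs : s ∈ Ioo (0 : ℝ) 1) (x : EuclideanSpace ℝ (Fin N)) :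
    0 ≤ Ps N s x := by
  have := Ks_pos (N := N) hs
  unfold Ps
  split_ifs <;> positivity

lemma Ps_le {s : ℝ} (hs : s ∈ Ioo (0 : ℝ) 1) (x : EuclideanSpace ℝ (Fin N)) :
    Ps N s x ≤ Ks N s * ‖x‖ ^ (s - N) := by
  have := Ks_pos (N := N) hs
  by_cases hx : 0 < x 0
  · have hn := norm_pos_of_apply_zero_pos hx
    rw [Ps_eq s hx, sub_eq_add_neg, Real.rpow_add hn, mul_assoc]
    gcongr
    · exact hs.1.le
    · exact apply_zero_le_norm x
  · rw [Ps, if_neg hx]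
    positivity

lemma pow_mul_rpow_sub {y : ℝ} (hy : 0 < y) (p : ℝ) :
    y ^ (N - 1) * y ^ (p - N) = y ^ (p - 1) := by
  rw [← Real.rpow_natCast, ← Real.rpow_add hy,
    Nat.cast_pred (Nat.pos_of_ne_zero (NeZero.ne N))]
  ring_nf

lemma integrable_norm_rpow_div {s : ℝ} (hs : s ∈ Ioo (0 : ℝ) 1) :
    Integrable fun x : EuclideanSpace ℝ (Fin N) =>
      ‖x‖ ^ (s - N) / (1 + ‖x‖ ^ ((N : ℝ) + 2 * s)) := by
  have hs0 := hs.1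
  have hN : (0 : ℝ) ≤ N := by positivity
  rw [integrable_fun_norm_addHaar volume
    (f := fun y : ℝ => y ^ (s - N) / (1 + y ^ ((N : ℝ) + 2 * s)))]
  simp only [finrank_euclideanSpace_fin, smul_eq_mul]
  refine integrableOn_Ioi_of_le_rpow (p := s - 1) (q := -s - N - 1) (by linarith)
    (by
      have : (0 : ℝ) < N := by exact_mod_cast Nat.pos_of_ne_zero (NeZero.ne N)
      linarith) (by fun_prop) (fun t ht => by positivity)
    (fun t ht => ?_) fun t ht => ?_
  · rw [← mul_div_assoc, pow_mul_rpow_sub ht]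
    exact div_le_self (by positivity) (by simp; positivity)
  · rw [← mul_div_assoc, pow_mul_rpow_sub ht]
    calc t ^ (s - 1) / (1 + t ^ ((N : ℝ) + 2 * s)) ≤ t ^ (s - 1) / t ^ ((N : ℝ) + 2 * s) := by
          gcongr
          linarith
      _ = t ^ (-s - N - 1) := by
          rw [← Real.rpow_sub ht]
          ring_nf

lemma pow_mul_indicator_rpow (p δ : ℝ) : EqOn
    (fun y : ℝ => y ^ (N - 1) * (Iio δ).indicator (fun y => y ^ (p - N)) y)
    ((Iio δ).indicator fun y => y ^ (p - 1)) (Ioi 0) := fun y hy => by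
  by_cases h : y ∈ Iio δ <;> simp [h, pow_mul_rpow_sub hy]

lemma integrable_indicator_norm_rpow {p : ℝ} (hp : 0 < p) (δ : ℝ) :
    Integrable fun x : EuclideanSpace ℝ (Fin N) =>
      (Iio δ).indicator (fun y : ℝ => y ^ (p - N)) ‖x‖ := by
  rw [integrable_fun_norm_addHaar volume (f := (Iio δ).indicator fun y : ℝ => y ^ (p - N))]
  simp only [finrank_euclideanSpace_fin, smul_eq_mul]
  rw [integrableOn_congr_fun (pow_mul_indicator_rpow p δ) measurableSet_Ioi, IntegrableOn,
    integrable_indicator_iff measurableSet_Iio, IntegrableOn,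
    Measure.restrict_restrict measurableSet_Iio, inter_comm, Ioi_inter_Iio]
  exact integrableOn_Ioo_rpow (by linarith) δ

lemma integral_indicator_norm_rpow {p δ : ℝ} (hp : 0 < p) (hδ : 0 ≤ δ) :
    ∫ x : EuclideanSpace ℝ (Fin N), (Iio δ).indicator (fun y : ℝ => y ^ (p - N)) ‖x‖ =
      N * (volume : Measure (EuclideanSpace ℝ (Fin N))).real (Metric.ball 0 1) * (δ ^ p / p) := by
  rw [integral_fun_norm_addHaar volume ((Iio δ).indicator fun y : ℝ => y ^ (p - N))]
  simp only [finrank_euclideanSpace_fin, smul_eq_mul, nsmul_eq_mul]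
  rw [setIntegral_congr_fun measurableSet_Ioi (pow_mul_indicator_rpow p δ),
    setIntegral_indicator measurableSet_Iio, Ioi_inter_Iio,
    integral_Ioo_rpow (by linarith) hδ, sub_add_cancel, mul_assoc]

/-- Far from the pole the rescaled Green kernel is dominated by the fundamental solution. -/
lemma rescaled_green_le_Ps (hN : 2 ≤ N) {s : ℝ} (hs : s ∈ Ioo (0 : ℝ) 1) {ε : ℝ} (hε : 0 < ε)
    {x : EuclideanSpace ℝ (Fin N)} (hx : 0 < x 0) (hxε : ε / 2 ≤ ‖x - ε • e1 N‖) :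
    ε ^ (-s) * Gs N s x (ε • e1 N) ≤ 3 ^ (N : ℝ) * Ps N s x := by
  have hr : 0 < ‖x - ε • e1 N‖ := by linarith
  have hK := Ks_pos (N := N) hs
  have hn := norm_pos_of_apply_zero_pos hx
  have h3 : ‖x‖ ≤ 3 * ‖x - ε • e1 N‖ := by
    have := norm_add_le (x - ε • e1 N) (ε • e1 N)
    rw [sub_add_cancel, norm_smul_e1 hε] at this
    linarith
  calc ε ^ (-s) * Gs N s x (ε • e1 N)
      ≤ Ks N s * (x 0) ^ s * ‖x - ε • e1 N‖ ^ (-(N : ℝ)) :=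
        rescaled_green_le hN hs hε hx (sub_ne_zero.1 (norm_pos_iff.1 hr))
    _ ≤ Ks N s * (x 0) ^ s * (‖x‖ / 3) ^ (-(N : ℝ)) := by
        gcongr ?_ * ?_
        exact Real.rpow_le_rpow_of_nonpos (by positivity) (by linarith) (by simp)
    _ = 3 ^ (N : ℝ) * Ps N s x := by
        rw [Ps_eq s hx, Real.div_rpow hn.le (by norm_num), Real.rpow_neg zero_le_three,
          div_inv_eq_mul]
        ring

/-- The weighted error with the singular part near the pole removed. -/
def truncatedError (N : ℕ) [NeZero N] (s ε : ℝ) (x : EuclideanSpace ℝ (Fin N)) : ℝ :=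
  (if ‖x - ε • e1 N‖ < ε / 2 then Ps N s x else |ε ^ (-s) * Gs N s x (ε • e1 N) - Ps N s x|) /
    (1 + ‖x‖ ^ ((N : ℝ) + 2 * s))

lemma measurable_truncatedError (hN : 2 ≤ N) {s : ℝ} (hs : s ∈ Ioo (0 : ℝ) 1) (ε : ℝ) :
    Measurable (truncatedError N s ε) := by
  have h1 := measurable_Gs_smul_e1 hN hs ε
  have h2 := measurable_Ps (N := N) s
  refine Measurable.div (Measurable.ite (measurableSet_lt (by fun_prop) measurable_const) h2 ?_)
    (by fun_prop)
  exact ((h1.const_mul _).sub h2).abs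

lemma norm_truncatedError_le (hN : 2 ≤ N) {s : ℝ} (hs : s ∈ Ioo (0 : ℝ) 1) {ε : ℝ} (hε : 0 < ε)
    {x : EuclideanSpace ℝ (Fin N)} (hx : 0 < x 0) :
    ‖truncatedError N s ε x‖ ≤
      3 ^ (N : ℝ) * Ks N s * (‖x‖ ^ (s - N) / (1 + ‖x‖ ^ ((N : ℝ) + 2 * s))) := by
  have hP := Ps_nonneg hs x
  have h3 : (1 : ℝ) ≤ 3 ^ (N : ℝ) := Real.one_le_rpow (by norm_num) (by positivity)
  have hP3 : Ps N s x ≤ 3 ^ (N : ℝ) * Ps N s x := le_mul_of_one_le_left hP h3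
  have hG : 0 ≤ ε ^ (-s) * Gs N s x (ε • e1 N) :=
    mul_nonneg (by positivity) (Gs_smul_e1_nonneg hs hε hx)
  have hmain : |(if ‖x - ε • e1 N‖ < ε / 2 then Ps N s x
      else |ε ^ (-s) * Gs N s x (ε • e1 N) - Ps N s x|)| ≤ 3 ^ (N : ℝ) * Ps N s x := by
    split_ifs with h
    · rwa [abs_of_nonneg hP]
    · rw [abs_abs]
      exact abs_sub_le_of_nonneg_of_le hG (rescaled_green_le_Ps hN hs hε hx (not_lt.1 h)) hP hP3
  rw [truncatedError, norm_div, Real.norm_eq_abs,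
    Real.norm_of_nonneg (by positivity : 0 ≤ 1 + ‖x‖ ^ ((N : ℝ) + 2 * s)), ← mul_div_assoc]
  gcongr
  calc _ ≤ 3 ^ (N : ℝ) * Ps N s x := hmain
    _ ≤ 3 ^ (N : ℝ) * (Ks N s * ‖x‖ ^ (s - N)) := by
        gcongr
        exact Ps_le hs x
    _ = _ := by ring

lemma tendsto_truncatedError (hN : 2 ≤ N) {s : ℝ} (hs : s ∈ Ioo (0 : ℝ) 1)
    {x : EuclideanSpace ℝ (Fin N)} (hx : 0 < x 0) :
    Tendsto (fun ε => truncatedError N s ε x) (𝓝[>] (0 : ℝ)) (𝓝 0) := by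
  have hn := norm_pos_of_apply_zero_pos hx
  have h := (((tendsto_rescaled_green_apply hN hs hx).sub_const (Ps N s x)).abs).div_const
    (1 + ‖x‖ ^ ((N : ℝ) + 2 * s))
  rw [sub_self, abs_zero, zero_div] at h
  refine h.congr' ?_
  filter_upwards [self_mem_nhdsWithin, nhdsWithin_le_nhds (gt_mem_nhds (half_pos hn))] with
    ε (hε : 0 < ε) hε'
  have h1 := norm_sub_norm_le x (ε • e1 N)
  rw [norm_smul_e1 hε] at h1
  rw [truncatedError, if_neg (by linarith)]

lemma tendsto_integral_truncatedError (hN : 2 ≤ N) {s : ℝ} (hs : s ∈ Ioo (0 : ℝ) 1) :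
    Tendsto (fun ε => ∫ x in {x : EuclideanSpace ℝ (Fin N) | 0 < x 0}, truncatedError N s ε x)
      (𝓝[>] (0 : ℝ)) (𝓝 0) := by
  have hH : MeasurableSet {x : EuclideanSpace ℝ (Fin N) | 0 < x 0} :=
    measurableSet_lt measurable_const (by fun_prop)
  have h := tendsto_integral_filter_of_dominated_convergence
    (μ := volume.restrict {x : EuclideanSpace ℝ (Fin N) | 0 < x 0}) (l := 𝓝[>] (0 : ℝ))
    (F := truncatedError N s) (f := fun _ => 0) _
    (.of_forall fun ε => (measurable_truncatedError hN hs ε).aestronglyMeasurable)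
    (eventually_mem_nhdsWithin.mono fun ε hε =>
      (ae_restrict_iff' hH).2 (.of_forall fun x hx => norm_truncatedError_le hN hs hε hx))
    ((integrable_norm_rpow_div hs).const_mul _).restrict
    ((ae_restrict_iff' hH).2 (.of_forall fun x hx => tendsto_truncatedError hN hs hx))
  simpa using h

lemma integrableOn_truncatedError (hN : 2 ≤ N) {s : ℝ} (hs : s ∈ Ioo (0 : ℝ) 1) {ε : ℝ}
    (hε : 0 < ε) :
    IntegrableOn (truncatedError N s ε) {x : EuclideanSpace ℝ (Fin N) | 0 < x 0} :=
  ((integrable_norm_rpow_div hs).const_mul _).restrict.mono'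
    (measurable_truncatedError hN hs ε).aestronglyMeasurable
    ((ae_restrict_iff' (measurableSet_lt measurable_const (by fun_prop))).2
      (.of_forall fun _ hx => norm_truncatedError_le hN hs hε hx))

/-- The rescaled Green kernel near the pole is bounded by a multiple of the Riesz kernel. -/
lemma weighted_error_le (hN : 2 ≤ N) {s : ℝ} (hs : s ∈ Ioo (0 : ℝ) 1) :
    ∃ C : ℝ, 0 ≤ C ∧ ∀ ε > 0, ∀ x : EuclideanSpace ℝ (Fin N), 0 < x 0 →
      |ε ^ (-s) * Gs N s x (ε • e1 N) - Ps N s x| / (1 + ‖x‖ ^ ((N : ℝ) + 2 * s)) ≤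
        C * ε ^ (-s) * (Iio (ε / 2)).indicator (fun y : ℝ => y ^ (2 * s - N)) ‖x - ε • e1 N‖ +
          truncatedError N s ε x := by
  have hk := kap_pos (N := N) hs
  set I := ∫ t in Ioi (0 : ℝ), t ^ (s - 1) * (1 + t) ^ (-(N : ℝ) / 2)
  have hI0 : 0 ≤ I := (greenPrimitive_nonneg N s 0).trans (greenPrimitive_le hN hs 0)
  refine ⟨kap N s / 2 * I, by positivity, fun ε hε x hx => ?_⟩
  by_cases h : ‖x - ε • e1 N‖ < ε / 2
  · have hP := Ps_nonneg hs x
    have hG := Gs_smul_e1_nonneg hs hε hx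
    rw [truncatedError, if_pos h, indicator_of_mem (show _ ∈ Iio (ε / 2) from h)]
    have hw : 1 ≤ 1 + ‖x‖ ^ ((N : ℝ) + 2 * s) := by
      have : 0 ≤ ‖x‖ ^ ((N : ℝ) + 2 * s) := by positivity
      linarith
    calc _ ≤ (ε ^ (-s) * Gs N s x (ε • e1 N) + Ps N s x) / (1 + ‖x‖ ^ ((N : ℝ) + 2 * s)) := by
          gcongr
          refine (abs_sub _ _).trans_eq ?_
          rw [abs_of_nonneg hP, abs_of_nonneg (by positivity)]
      _ ≤ ε ^ (-s) * Gs N s x (ε • e1 N) + Ps N s x / (1 + ‖x‖ ^ ((N : ℝ) + 2 * s)) := by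
          rw [add_div]
          gcongr
          exact div_le_self (by positivity) hw
      _ ≤ _ := by
          refine add_le_add_left ?_ _
          rw [Gs_smul_e1 s hε hx]
          calc _ ≤ ε ^ (-s) * (kap N s / 2 * ‖x - ε • e1 N‖ ^ (2 * s - (N : ℝ)) * I) := by
                gcongr
                exact greenPrimitive_le hN hs _
            _ = _ := by ring
  · rw [truncatedError, if_neg h, indicator_of_notMem (show _ ∉ Iio (ε / 2) from h)]
    simp

lemma tendsto_integral_weighted_error (hN : 2 ≤ N) {s : ℝ} (hs : s ∈ Ioo (0 : ℝ) 1) :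
    Tendsto (fun ε : ℝ => ∫ x in {x : EuclideanSpace ℝ (Fin N) | 0 < x 0},
        |ε ^ (-s) * Gs N s x (ε • e1 N) - Ps N s x| / (1 + ‖x‖ ^ ((N : ℝ) + 2 * s)))
      (𝓝[>] (0 : ℝ)) (𝓝 0) := by
  obtain ⟨C, hC, hbound⟩ := weighted_error_le hN hs
  have hs0 := hs.1
  have hH : MeasurableSet {x : EuclideanSpace ℝ (Fin N) | 0 < x 0} :=
    measurableSet_lt measurable_const (by fun_prop)
  set c := (volume : Measure (EuclideanSpace ℝ (Fin N))).real (Metric.ball 0 1) with hc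
  have hlim : Tendsto (fun ε : ℝ => C * (N * c * ((2 : ℝ) ^ (2 * s))⁻¹ / (2 * s)) * ε ^ s +
      ∫ x in {x : EuclideanSpace ℝ (Fin N) | 0 < x 0}, truncatedError N s ε x)
      (𝓝[>] (0 : ℝ)) (𝓝 0) := by
    have h0 : Tendsto (fun ε : ℝ => ε ^ s) (𝓝[>] (0 : ℝ)) (𝓝 0) := by
      have := (Real.continuousAt_rpow_const 0 s (Or.inr hs0.le)).tendsto
      rw [Real.zero_rpow hs0.ne'] at this
      exact this.mono_left nhdsWithin_le_nhds
    simpa using (h0.const_mul _).add (tendsto_integral_truncatedError hN hs)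
  refine squeeze_zero' (.of_forall fun ε => integral_nonneg fun x => by positivity) ?_ hlim
  filter_upwards [self_mem_nhdsWithin] with ε (hε : 0 < ε)
  have hA : Integrable fun x : EuclideanSpace ℝ (Fin N) => C * ε ^ (-s) *
      (Iio (ε / 2)).indicator (fun y : ℝ => y ^ (2 * s - N)) ‖x - ε • e1 N‖ :=
    ((integrable_indicator_norm_rpow (p := 2 * s) (by positivity) (ε / 2)).comp_sub_right
      (ε • e1 N)).const_mul _
  have hT := integrableOn_truncatedError hN hs hε
  calc _ ≤ ∫ x in {x : EuclideanSpace ℝ (Fin N) | 0 < x 0}, (C * ε ^ (-s) *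
        (Iio (ε / 2)).indicator (fun y : ℝ => y ^ (2 * s - N)) ‖x - ε • e1 N‖ +
          truncatedError N s ε x) :=
        integral_mono_of_nonneg (.of_forall fun x => by simp only [Pi.zero_apply]; positivity)
          (hA.restrict.add hT) ((ae_restrict_iff' hH).2 (.of_forall fun x hx => hbound ε hε x hx))
    _ = (∫ x in {x : EuclideanSpace ℝ (Fin N) | 0 < x 0}, C * ε ^ (-s) *
        (Iio (ε / 2)).indicator (fun y : ℝ => y ^ (2 * s - N)) ‖x - ε • e1 N‖) + _ :=
        integral_add hA.restrict hT
    _ ≤ _ := by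
        gcongr
        refine (setIntegral_le_integral hA (.of_forall fun x => ?_)).trans_eq ?_
        · exact mul_nonneg (by positivity)
            (indicator_apply_nonneg fun _ => by positivity)
        · rw [integral_const_mul, integral_sub_right_eq_self
              (fun x => (Iio (ε / 2)).indicator (fun y : ℝ => y ^ (2 * s - N)) ‖x‖) (ε • e1 N),
            integral_indicator_norm_rpow (by positivity) (by positivity),
            Real.div_rpow hε.le zero_le_two, show 2 * s = s + s by ring,
            Real.rpow_add hε, Real.rpow_neg hε.le, ← hc]
          have : ε ^ s ≠ 0 := by positivity
          field_simp

/-- `ε^{-s} 𝒢_{s,∞}(·, ε e₁) → 𝒫_s` as `ε → 0⁺`, in the weighted space `L¹_s(ℝ^N_+)` and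
uniformly on every compact subset of `ℝ^N_+`. -/
theorem green_approx_L1s_and_unif
    (N : ℕ) [NeZero N] (hN : 2 ≤ N) (s : ℝ) (hs : s ∈ Ioo (0 : ℝ) 1) :
    Tendsto (fun ε : ℝ => ∫ x in {x : EuclideanSpace ℝ (Fin N) | 0 < x 0},
        |ε ^ (-s) * Gs N s x (ε • e1 N) - Ps N s x| / (1 + ‖x‖ ^ ((N : ℝ) + 2 * s)))
      (𝓝[>] (0 : ℝ)) (𝓝 0) ∧
    ∀ O : Set (EuclideanSpace ℝ (Fin N)), IsCompact O → O ⊆ {x | 0 < x 0} →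
      TendstoUniformlyOn (fun (ε : ℝ) (x : EuclideanSpace ℝ (Fin N)) =>
        ε ^ (-s) * Gs N s x (ε • e1 N)) (Ps N s) (𝓝[>] (0 : ℝ)) O := by
  exact ⟨tendsto_integral_weighted_error hN hs,
    fun _ hO hO' => tendstoUniformlyOn_rescaled_green hN hs hO hO'⟩
end
end

section
/- Let N ≥ 2 and s ∈ (0,1). For x ∈ ℝ^N_+ and ε > 0 one has ε^s 𝒫_{s,∞}(x, −ε e_1) = 𝒦_s x_1^s |x + ε e_1|^{−N}, and ε^s 𝒫_{s,∞}(·, −ε e_1) → 𝒫_s as ε → 0^+ in L^1_s(ℝ^N_+) and uniformly on every compact subset of ℝ^N_+; that is, lim_{ε→0^+} ∫_{ℝ^N_+} |𝒦_s x_1^s |x+εe_1|^{−N} − 𝒫_s(x)| (1+|x|^{N+2s})^{−1} dx = 0 and sup_{x ∈ O} |𝒦_s x_1^s |x+εe_1|^{−N} − 𝒫_s(x)| → 0 for every compact O ⊂ ℝ^N_+. -/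
open MeasureTheory Real Filter Set Topology

noncomputable section

/-- The Poisson kernel `𝒫_{s,∞}(x,y) = 𝒦_s (x₁/(-y₁))^s |x-y|^{-N}` of the half-space. -/
def Psi (N : ℕ) [NeZero N] (s : ℝ) (x y : EuclideanSpace ℝ (Fin N)) : ℝ :=
  Ks N s * (x 0 / (-(y 0))) ^ s * ‖x - y‖ ^ (-(N : ℝ))

lemma norm_le_norm_add_smul_e1 {N : ℕ} [NeZero N] {x : EuclideanSpace ℝ (Fin N)} (hx : 0 ≤ x 0)
    {ε : ℝ} (hε : 0 ≤ ε) : ‖x‖ ≤ ‖x + ε • e1 N‖ := by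
  have h1 : inner ℝ x (ε • e1 N) = ε * x 0 := by
    simp [e1, inner_smul_right, EuclideanSpace.inner_single_right]
  have h2 := norm_add_sq_real x (ε • e1 N)
  refine le_of_sq_le_sq ?_ (norm_nonneg _)
  rw [h2, h1]
  have := mul_nonneg hε hx
  nlinarith [sq_nonneg ‖ε • e1 N‖]

lemma norm_pos_of_coord_pos {N : ℕ} [NeZero N] {x : EuclideanSpace ℝ (Fin N)} (hx : 0 < x 0) :
    0 < ‖x‖ := by
  refine norm_pos_iff.2 ?_
  rintro rfl
  simp at hx

lemma norm_add_smul_e1_pos {N : ℕ} [NeZero N] {x : EuclideanSpace ℝ (Fin N)} (hx : 0 < x 0)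
    {ε : ℝ} (hε : 0 ≤ ε) : 0 < ‖x + ε • e1 N‖ :=
  (norm_pos_of_coord_pos hx).trans_le (norm_le_norm_add_smul_e1 hx.le hε)

lemma integrableOn_Ioi_rpow_div_one_add_rpow {a b : ℝ} (ha : -1 < a) (hab : a - b < -1) :
    IntegrableOn (fun r : ℝ => r ^ a / (1 + r ^ b)) (Ioi 0) := by
  have hm : ∀ t : Set ℝ,
      AEStronglyMeasurable (fun r : ℝ => r ^ a / (1 + r ^ b)) (volume.restrict t) := fun t =>
    (by fun_prop : Measurable (fun r : ℝ => r ^ a / (1 + r ^ b))).aestronglyMeasurable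
  rw [← Ioc_union_Ioi_eq_Ioi (zero_le_one (α := ℝ))]
  refine IntegrableOn.union ?_ ?_
  · have h : IntegrableOn (fun r : ℝ => r ^ a) (Ioc 0 1) :=
      (intervalIntegrable_iff_integrableOn_Ioc_of_le zero_le_one).1
        (intervalIntegral.intervalIntegrable_rpow' ha)
    refine Integrable.mono' h (hm _) ?_
    filter_upwards [ae_restrict_mem measurableSet_Ioc] with r hr
    have hb := rpow_nonneg hr.1.le b
    have ha := rpow_nonneg hr.1.le a
    rw [Real.norm_of_nonneg (by positivity)]
    exact div_le_self ha (by linarith)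
  · refine Integrable.mono' (integrableOn_Ioi_rpow_of_lt hab zero_lt_one) (hm _) ?_
    filter_upwards [ae_restrict_mem measurableSet_Ioi] with r hr
    have hr0 : 0 < r := zero_lt_one.trans hr
    have hb := rpow_pos_of_pos hr0 b
    have ha := rpow_pos_of_pos hr0 a
    rw [Real.norm_of_nonneg (by positivity), rpow_sub hr0]
    gcongr
    linarith

lemma integrable_norm_rpow_div_one_add_norm_rpow {N : ℕ} (hN : 1 ≤ N) {a b : ℝ}
    (ha : -(N : ℝ) < a) (hab : a - b < -(N : ℝ)) :
    Integrable (fun x : EuclideanSpace ℝ (Fin N) => ‖x‖ ^ a / (1 + ‖x‖ ^ b)) := by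
  have : Nonempty (Fin N) := ⟨⟨0, hN⟩⟩
  rw [integrable_fun_norm_addHaar volume (f := fun r : ℝ => r ^ a / (1 + r ^ b)),
    finrank_euclideanSpace_fin]
  refine (integrableOn_Ioi_rpow_div_one_add_rpow (a := a + (N - 1)) (b := b)
    (by linarith) (by linarith)).congr_fun (fun r hr => ?_) measurableSet_Ioi
  have hr : 0 < r := hr
  simp only [smul_eq_mul]
  rw [rpow_add hr, show ((N : ℝ) - 1) = ((N - 1 : ℕ) : ℝ) by push_cast [hN]; rfl, rpow_natCast]
  ring

/-- For points of the half-space, the shifted kernel is dominated by `|x|^{s-N}`. -/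
lemma coord_rpow_mul_norm_add_rpow_le {N : ℕ} [NeZero N] {s : ℝ} (hs : 0 ≤ s)
    {x : EuclideanSpace ℝ (Fin N)} (hx : 0 < x 0) {ε : ℝ} (hε : 0 ≤ ε) :
    (x 0) ^ s * ‖x + ε • e1 N‖ ^ (-(N : ℝ)) ≤ ‖x‖ ^ (s - N) := by
  have hn := norm_pos_of_coord_pos hx
  rw [sub_eq_add_neg, rpow_add hn]
  have h0 : x 0 ≤ ‖x‖ := (le_abs_self _).trans (PiLp.norm_apply_le x 0)
  refine mul_le_mul (rpow_le_rpow hx.le h0 hs) ?_ (by positivity) (by positivity)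
  exact rpow_le_rpow_of_nonpos hn (norm_le_norm_add_smul_e1 hx.le hε) (by simp)

lemma continuousOn_shifted_kernel (N : ℕ) [NeZero N] (s : ℝ) :
    ContinuousOn (fun p : ℝ × EuclideanSpace ℝ (Fin N) =>
      Ks N s * (p.2 0) ^ s * ‖p.2 + p.1 • e1 N‖ ^ (-(N : ℝ)))
      (Ici 0 ×ˢ {x | 0 < x 0}) := by
  refine ContinuousOn.mul (continuousOn_const.mul ?_) ?_
  · exact ContinuousOn.rpow_const (by fun_prop) fun p hp => Or.inl (ne_of_gt hp.2)
  · exact ContinuousOn.rpow_const (by fun_prop)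
      fun p hp => Or.inl (norm_add_smul_e1_pos hp.2 hp.1).ne'

lemma Ps_eq_shifted_kernel_zero {N : ℕ} [NeZero N] (s : ℝ) {x : EuclideanSpace ℝ (Fin N)}
    (hx : 0 < x 0) :
    Ps N s x = Ks N s * (x 0) ^ s * ‖x + (0 : ℝ) • e1 N‖ ^ (-(N : ℝ)) := by
  simp [Ps, hx]

lemma tendstoUniformlyOn_shifted_kernel {N : ℕ} [NeZero N] (s : ℝ)
    {O : Set (EuclideanSpace ℝ (Fin N))} (hO : IsCompact O) (hpos : O ⊆ {x | 0 < x 0}) :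
    TendstoUniformlyOn (fun (ε : ℝ) (x : EuclideanSpace ℝ (Fin N)) =>
      Ks N s * (x 0) ^ s * ‖x + ε • e1 N‖ ^ (-(N : ℝ))) (Ps N s) (𝓝[>] (0 : ℝ)) O := by
  intro u hu
  obtain ⟨v, hv, h⟩ := hO.mem_uniformity_of_prod
    (f := fun (ε : ℝ) (x : EuclideanSpace ℝ (Fin N)) =>
      Ks N s * (x 0) ^ s * ‖x + ε • e1 N‖ ^ (-(N : ℝ)))
    ((continuousOn_shifted_kernel N s).mono (prod_mono_right hpos)) self_mem_Ici
    (symm_le_uniformity hu)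
  filter_upwards [nhdsWithin_mono _ Ioi_subset_Ici_self hv] with ε hε x hx
  rw [Ps_eq_shifted_kernel_zero s (hpos hx)]
  exact h ε hε x hx

lemma measurable_shifted_kernel_sub_Ps (N : ℕ) [NeZero N] (s ε : ℝ) :
    Measurable (fun x : EuclideanSpace ℝ (Fin N) =>
      |Ks N s * (x 0) ^ s * ‖x + ε • e1 N‖ ^ (-(N : ℝ)) - Ps N s x|
        / (1 + ‖x‖ ^ ((N : ℝ) + 2 * s))) := by
  have hP : Measurable (Ps N s) := by
    unfold Ps
    exact Measurable.ite (measurableSet_lt (by fun_prop) (by fun_prop)) (by fun_prop)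
      (by fun_prop)
  refine Measurable.div ?_ (by fun_prop)
  exact continuous_abs.measurable.comp (Measurable.sub (by fun_prop) hP)

lemma tendsto_integral_shifted_kernel {N : ℕ} [NeZero N] {s : ℝ} (hs : 0 < s) :
    Tendsto (fun ε : ℝ => ∫ x in {x : EuclideanSpace ℝ (Fin N) | 0 < x 0},
        |Ks N s * (x 0) ^ s * ‖x + ε • e1 N‖ ^ (-(N : ℝ)) - Ps N s x|
          / (1 + ‖x‖ ^ ((N : ℝ) + 2 * s)))
      (𝓝[>] (0 : ℝ)) (𝓝 0) := by
  have hmeas : MeasurableSet {x : EuclideanSpace ℝ (Fin N) | 0 < x 0} :=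
    measurableSet_lt (by fun_prop) (by fun_prop)
  have hN : (1 : ℝ) ≤ N := by exact_mod_cast NeZero.one_le
  have hint := (integrable_norm_rpow_div_one_add_norm_rpow (N := N) NeZero.one_le
    (a := s - N) (b := N + 2 * s) (by linarith) (by linarith)).const_mul (2 * |Ks N s|)
  rw [show 𝓝 (0 : ℝ) = 𝓝 (∫ _ in {x : EuclideanSpace ℝ (Fin N) | 0 < x 0}, (0 : ℝ)) by simp]
  refine tendsto_integral_filter_of_dominated_convergence
    (fun x => 2 * |Ks N s| * (‖x‖ ^ (s - N) / (1 + ‖x‖ ^ (N + 2 * s))))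
    (Eventually.of_forall fun ε =>
      (measurable_shifted_kernel_sub_Ps N s ε).aestronglyMeasurable) ?_ hint.integrableOn ?_
  · filter_upwards [self_mem_nhdsWithin] with ε hε
    have hε : 0 < ε := hε
    filter_upwards [ae_restrict_mem hmeas] with x hx
    have hx : 0 < x 0 := hx
    have hb (δ : ℝ) (hδ : 0 ≤ δ) :
        |Ks N s * (x 0) ^ s * ‖x + δ • e1 N‖ ^ (-(N : ℝ))| ≤ |Ks N s| * ‖x‖ ^ (s - N) := by
      rw [mul_assoc, abs_mul, abs_of_nonneg (a := (x 0) ^ s * _) (by positivity)]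
      exact mul_le_mul_of_nonneg_left (coord_rpow_mul_norm_add_rpow_le hs.le hx hδ)
        (abs_nonneg _)
    rw [Real.norm_of_nonneg (by positivity), ← mul_div_assoc]
    gcongr
    rw [Ps_eq_shifted_kernel_zero s hx]
    refine (abs_sub _ _).trans ?_
    linarith [hb ε hε.le, hb 0 le_rfl]
  · filter_upwards [ae_restrict_mem hmeas] with x hx
    have h := (tendstoUniformlyOn_shifted_kernel s isCompact_singleton
      (singleton_subset_iff.2 hx)).tendsto_at (mem_singleton x)
    simpa using ((h.sub_const (Ps N s x)).abs).div_const (1 + ‖x‖ ^ ((N : ℝ) + 2 * s))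

lemma rpow_mul_Psi_neg_smul_e1 {N : ℕ} [NeZero N] (s : ℝ) {x : EuclideanSpace ℝ (Fin N)}
    (hx : 0 < x 0) {ε : ℝ} (hε : 0 < ε) :
    ε ^ s * Psi N s x (-(ε • e1 N)) =
      Ks N s * (x 0) ^ s * ‖x + ε • e1 N‖ ^ (-(N : ℝ)) := by
  have h1 : -((-(ε • e1 N)) 0) = ε := by simp [e1]
  have h2 := (rpow_pos_of_pos hε s).ne'
  rw [Psi, h1, sub_neg_eq_add, div_rpow hx.le hε.le]
  field_simp

/-- `ε^s 𝒫_{s,∞}(x, -ε e₁) = 𝒦_s x₁^s |x + ε e₁|^{-N}` for `x ∈ ℝ^N_+`, `ε > 0`, and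
`ε^s 𝒫_{s,∞}(·, -ε e₁) → 𝒫_s` as `ε → 0⁺` in `L¹_s(ℝ^N_+)` and uniformly on every
compact subset of `ℝ^N_+`. -/
theorem poisson_approx
    (N : ℕ) [NeZero N] (hN : 2 ≤ N) (s : ℝ) (hs : s ∈ Ioo (0 : ℝ) 1) :
    (∀ x : EuclideanSpace ℝ (Fin N), 0 < x 0 → ∀ ε : ℝ, 0 < ε →
        ε ^ s * Psi N s x (-(ε • e1 N)) = Ks N s * (x 0) ^ s * ‖x + ε • e1 N‖ ^ (-(N : ℝ))) ∧
    Tendsto (fun ε : ℝ => ∫ x in {x : EuclideanSpace ℝ (Fin N) | 0 < x 0},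
        |Ks N s * (x 0) ^ s * ‖x + ε • e1 N‖ ^ (-(N : ℝ)) - Ps N s x|
          / (1 + ‖x‖ ^ ((N : ℝ) + 2 * s)))
      (𝓝[>] (0 : ℝ)) (𝓝 0) ∧
    ∀ O : Set (EuclideanSpace ℝ (Fin N)), IsCompact O → O ⊆ {x | 0 < x 0} →
      TendstoUniformlyOn (fun (ε : ℝ) (x : EuclideanSpace ℝ (Fin N)) =>
        Ks N s * (x 0) ^ s * ‖x + ε • e1 N‖ ^ (-(N : ℝ))) (Ps N s) (𝓝[>] (0 : ℝ)) O := by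
  exact ⟨fun x hx ε hε => rpow_mul_Psi_neg_smul_e1 s hx hε,
    tendsto_integral_shifted_kernel hs.1,
    fun O hO hpos => tendstoUniformlyOn_shifted_kernel s hO hpos⟩
end
end
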